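/- Let (R, m) be a commutative Noetherian local ring that is complete in its m-adic topology, let E be an injective R-module containing R/m as an essential submodule, and let M be a Matlis reflexive R-module, i.e., the natural evaluation map M → Hom_R(Hom_R(M, E), E) is an isomorphism. Let I be an ideal and N a finitely generated R-module such that Supp(M) ∩ Supp(N) ∩ V(I) = {m}. Fix i ≥ 0 and assume Ext_R^i(N/I^n N, M) has finite length for all sufficiently large n. Then there exists a polynomial p with rational coefficients such that λ(Ext_R^i(N/I^n N, M)) = p(n) for all sufficiently large n. -/

import Mathlib

set_option synthInstance.maxHeartbeats 1000000

open CategoryTheory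

universe u

/-- The length `λ(M)` of a module `M`, realized as the Krull dimension of the lattice of
submodules of `M`. -/
noncomputable def moduleLength (R M : Type*) [Ring R] [AddCommGroup M] [Module R M] :
    WithBot ℕ∞ :=
  Order.krullDim (Submodule R M)

/-- `Ext_R^i(A, B)`, as an `R`-module. -/
noncomputable abbrev extModule (R : Type u) [CommRing R] (i : ℕ) (A B : Type u)
    [AddCommGroup A] [Module R A] [AddCommGroup B] [Module R B] : Type u :=
  ↥(((Ext R (ModuleCat.{u} R) i).obj (Opposite.op (ModuleCat.of R A))).obj (ModuleCat.of R B))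

/-- The Matlis-duality evaluation map `M → Hom_R(Hom_R(M, E), E)`. -/
noncomputable def matlisEval (R M E : Type u) [CommRing R] [AddCommGroup M] [Module R M]
    [AddCommGroup E] [Module R E] : M →ₗ[R] ((M →ₗ[R] E) →ₗ[R] E) :=
  (LinearMap.id : (M →ₗ[R] E) →ₗ[R] (M →ₗ[R] E)).flip

set_option linter.unusedSectionVars false

/-! ### Eventually polynomial functions -/

/-- A function `ℕ → ℚ` which agrees with a polynomial for large arguments. -/
def EventuallyPolynomial (f : ℕ → ℚ) : Prop :=
  ∃ p : Polynomial ℚ, ∀ᶠ n in Filter.atTop, f n = p.eval (n : ℚ)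

namespace EventuallyPolynomial

variable {f g : ℕ → ℚ}

theorem congr (hf : EventuallyPolynomial f) (h : ∀ᶠ n in Filter.atTop, g n = f n) :
    EventuallyPolynomial g := by
  obtain ⟨p, hp⟩ := hf
  exact ⟨p, by filter_upwards [hp, h] with n h₁ h₂; rw [h₂, h₁]⟩

theorem add (hf : EventuallyPolynomial f) (hg : EventuallyPolynomial g) :
    EventuallyPolynomial (fun n ↦ f n + g n) := by
  obtain ⟨p, hp⟩ := hf
  obtain ⟨q, hq⟩ := hg
  exact ⟨p + q, by filter_upwards [hp, hq] with n h₁ h₂; simp [h₁, h₂]⟩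

theorem sub (hf : EventuallyPolynomial f) (hg : EventuallyPolynomial g) :
    EventuallyPolynomial (fun n ↦ f n - g n) := by
  obtain ⟨p, hp⟩ := hf
  obtain ⟨q, hq⟩ := hg
  exact ⟨p - q, by filter_upwards [hp, hq] with n h₁ h₂; simp [h₁, h₂]⟩

/-- Shifting the argument preserves eventual polynomiality. -/
theorem of_shift (c : ℕ) (hf : EventuallyPolynomial (fun n ↦ f (n + c))) :
    EventuallyPolynomial f := by
  obtain ⟨p, hp⟩ := hf
  obtain ⟨N, hN⟩ := Filter.eventually_atTop.1 hp
  refine ⟨p.comp (Polynomial.X - Polynomial.C (c : ℚ)), ?_⟩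
  filter_upwards [Filter.eventually_ge_atTop (N + c)] with n hn
  have := hN (n - c) (by omega)
  simp only [Nat.sub_add_cancel (show c ≤ n by omega)] at this
  simp [this, Nat.cast_sub (show c ≤ n by omega)]

end EventuallyPolynomial

theorem Polynomial.exists_eval_add_one_sub_eval (p : Polynomial ℚ) :
    ∃ q : Polynomial ℚ, ∀ n : ℕ, q.eval ((n : ℚ) + 1) - q.eval (n : ℚ) = p.eval (n : ℚ) := by
  induction p using Polynomial.induction_on' with
  | add p q hp hq =>
    obtain ⟨p', hp⟩ := hp
    obtain ⟨q', hq⟩ := hq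
    refine ⟨p' + q', fun n ↦ ?_⟩
    rw [Polynomial.eval_add, Polynomial.eval_add, Polynomial.eval_add, ← hp, ← hq]
    ring
  | monomial k a =>
    refine ⟨Polynomial.C (a / (k + 1)) * Polynomial.bernoulli (k + 1), fun n ↦ ?_⟩
    have h := Polynomial.bernoulli_eval_one_add (k + 1) (n : ℚ)
    rw [Polynomial.eval_mul, Polynomial.eval_mul, add_comm (n : ℚ), h]
    have : (k : ℚ) + 1 ≠ 0 := by positivity
    simp
    field_simp
    ring

theorem EventuallyPolynomial.of_sub {f : ℕ → ℚ}
    (hf : EventuallyPolynomial (fun n ↦ f (n + 1) - f n)) : EventuallyPolynomial f := by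
  obtain ⟨p, hp⟩ := hf
  obtain ⟨N, hN⟩ := Filter.eventually_atTop.1 hp
  obtain ⟨q, hq⟩ := p.exists_eval_add_one_sub_eval
  refine ⟨q + Polynomial.C (f N - q.eval (N : ℚ)), ?_⟩
  filter_upwards [Filter.eventually_ge_atTop N] with n hn
  induction n, hn using Nat.le_induction with
  | base => simp
  | succ n hn ih =>
    have h₁ := hN n hn
    have h₂ := hq n
    simp only [Polynomial.eval_add, Polynomial.eval_C] at ih ⊢
    push_cast
    linarith

/-! ### Relative length of submodules -/

section RelLength

variable {R V V' : Type*} [CommRing R] [AddCommGroup V] [Module R V] [AddCommGroup V'] [Module R V']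

/-- The length of `U / (D ∩ U)`. -/
noncomputable def relLength (D U : Submodule R V) : ℕ∞ :=
  Module.length R (U ⧸ D.comap U.subtype)

/-- The isomorphism theorem for relative lengths. -/
theorem relLength_map (g : V →ₗ[R] V') (U : Submodule R V) (D : Submodule R V')
    (D₁ : Submodule R V) (h : U ⊓ D₁ = U ⊓ D.comap g) :
    relLength D₁ U = relLength D (D ⊔ U.map g) := by
  let W : Submodule R V' := D ⊔ U.map g
  let k : U →ₗ[R] W ⧸ D.comap W.subtype :=
    (D.comap W.subtype).mkQ ∘ₗ (g.restrict (fun x hx ↦ Submodule.mem_sup_right ⟨x, hx, rfl⟩) :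
      U →ₗ[R] W)
  have hk : LinearMap.ker k = D₁.comap U.subtype := by
    ext ⟨x, hx⟩
    have := SetLike.ext_iff.1 h x
    simp only [Submodule.mem_inf, hx, true_and, Submodule.mem_comap] at this
    rw [LinearMap.mem_ker, LinearMap.comp_apply, Submodule.mkQ_apply,
      Submodule.Quotient.mk_eq_zero]
    exact this.symm
  have hs : Function.Surjective k := by
    intro y
    obtain ⟨⟨y, hy⟩, rfl⟩ := Submodule.mkQ_surjective _ y
    obtain ⟨d, hd, _, ⟨x, hx, rfl⟩, rfl⟩ := Submodule.mem_sup.1 hy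
    refine ⟨⟨x, hx⟩, ?_⟩
    simp only [k, LinearMap.comp_apply, Submodule.mkQ_apply]
    rw [Submodule.Quotient.eq, Submodule.mem_comap]
    simpa [LinearMap.restrict_apply] using hd
  unfold relLength
  rw [← hk]
  exact (k.quotKerEquivOfSurjective hs).length_eq

theorem relLength_sup (D U : Submodule R V) : relLength D (D ⊔ U) = relLength D U := by
  have := relLength_map LinearMap.id U D D (by simp)
  rw [Submodule.map_id] at this
  exact this.symm

theorem relLength_inf (D U : Submodule R V) : relLength (U ⊓ D) U = relLength D U := by
  rw [← relLength_sup D U]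
  have := relLength_map LinearMap.id U D (U ⊓ D) (by simp)
  rwa [Submodule.map_id] at this

theorem relLength_add {D S U : Submodule R V} (h₁ : D ≤ S) (h₂ : S ≤ U) :
    relLength D U = relLength D S + relLength S U := by
  have hle : D.comap S.subtype ≤ (D.comap U.subtype).comap (Submodule.inclusion h₂) :=
    fun x hx ↦ hx
  have hle' : D.comap U.subtype ≤ (S.comap U.subtype).comap LinearMap.id := fun x hx ↦ h₁ hx
  refine Module.length_eq_add_of_exact (Submodule.mapQ _ _ (Submodule.inclusion h₂) hle)
    (Submodule.mapQ _ _ LinearMap.id hle') ?_ ?_ ?_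
  · rw [← LinearMap.ker_eq_bot, Submodule.ker_mapQ, eq_bot_iff, Submodule.map_le_iff_le_comap]
    intro x hx
    simpa using hx
  · intro x
    obtain ⟨x, rfl⟩ := Submodule.mkQ_surjective _ x
    exact ⟨Submodule.Quotient.mk x, rfl⟩
  · intro x
    obtain ⟨⟨x, hx⟩, rfl⟩ := Submodule.mkQ_surjective _ x
    simp only [Submodule.mkQ_apply, Submodule.mapQ_apply, LinearMap.id_apply,
      Submodule.Quotient.mk_eq_zero, Submodule.mem_comap, Submodule.subtype_apply]
    constructor
    · intro h
      exact ⟨Submodule.Quotient.mk ⟨x, h⟩, rfl⟩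
    · rintro ⟨y, hy⟩
      obtain ⟨⟨y, hy'⟩, rfl⟩ := Submodule.mkQ_surjective _ y
      rw [Submodule.mkQ_apply, Submodule.mapQ_apply, Submodule.Quotient.eq] at hy
      have : y - x ∈ D := hy
      have := S.sub_mem hy' (h₁ this)
      simpa using this

theorem relLength_eq_zero {D U : Submodule R V} (h : U ≤ D) : relLength D U = 0 := by
  unfold relLength
  rw [Module.length_eq_zero_iff, Submodule.Quotient.subsingleton_iff, eq_top_iff]
  exact fun x _ ↦ h x.2

end RelLength

/-! ### Hilbert functions -/

section Hilbert

variable {R V : Type*} [CommRing R] [AddCommGroup V] [Module R V]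

/-- A form of the Hilbert–Serre theorem for a graded subquotient `⨁ U n / D n`, where the
Noetherian property is phrased as: every graded submodule is eventually generated in the previous
degree. -/
theorem eventuallyPolynomial_relLength (r : ℕ) (x : Fin r → R) (D U : ℕ → Submodule R V)
    (hDU : ∀ n, D n ≤ U n) (hU : ∀ j n, (U n).map (LinearMap.lsmul R V (x j)) ≤ U (n + 1))
    (hD : ∀ j n, (D n).map (LinearMap.lsmul R V (x j)) ≤ D (n + 1))
    (hN : ∀ S : ℕ → Submodule R V, (∀ n, D n ≤ S n) → (∀ n, S n ≤ U n) →
      (∀ j n, (S n).map (LinearMap.lsmul R V (x j)) ≤ S (n + 1)) →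
      ∀ᶠ n in Filter.atTop,
        S (n + 1) ≤ D (n + 1) ⊔ ⨆ j, (S n).map (LinearMap.lsmul R V (x j)))
    (hfin : ∀ᶠ n in Filter.atTop, relLength (D n) (U n) ≠ ⊤) :
    EventuallyPolynomial fun n ↦ ((relLength (D n) (U n)).toNat : ℚ) := by
  induction r generalizing D U with
  | zero =>
    refine ⟨0, ?_⟩
    obtain ⟨N, hN⟩ := Filter.eventually_atTop.1 (hN U hDU (fun n ↦ le_rfl) hU)
    filter_upwards [Filter.eventually_ge_atTop (N + 1)] with n hn
    obtain ⟨n, rfl⟩ : ∃ k, n = k + 1 := ⟨n - 1, by omega⟩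
    have := hN n (by omega)
    rw [iSup_of_empty, sup_bot_eq] at this
    simp [relLength_eq_zero this]
  | succ r ih =>
    let g := LinearMap.lsmul R V (x (Fin.last r))
    let K : ℕ → Submodule R V := fun n ↦ U n ⊓ (D (n + 1)).comap g
    let C : ℕ → Submodule R V := fun n ↦ D (n + 1) ⊔ (U n).map g
    have hDK : ∀ n, D n ≤ K n := fun n ↦ le_inf (hDU n)
      (Submodule.map_le_iff_le_comap.1 (hD (Fin.last r) n))
    have hKU : ∀ n, K n ≤ U n := fun n ↦ inf_le_left
    have hDC : ∀ n, D (n + 1) ≤ C n := fun n ↦ le_sup_left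
    have hCU : ∀ n, C n ≤ U (n + 1) := fun n ↦ sup_le (hDU _) (hU _ _)
    have e₁ : ∀ n, relLength (D n) (U n) = relLength (D n) (K n) + relLength (D (n + 1)) (C n) := by
      intro n
      rw [relLength_add (hDK n) (hKU n)]
      congr 1
      exact relLength_map g (U n) (D (n + 1)) (K n) (by simp [K])
    have e₂ : ∀ n, relLength (D (n + 1)) (U (n + 1)) =
        relLength (D (n + 1)) (C n) + relLength (C n) (U (n + 1)) :=
      fun n ↦ relLength_add (hDC n) (hCU n)
    have hfin' : ∀ᶠ n in Filter.atTop, relLength (D (n + 1)) (U (n + 1)) ≠ ⊤ :=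
      (Filter.tendsto_add_atTop_nat 1).eventually hfin
    have hcomm : ∀ (a b : R) (S : Submodule R V),
        (S.map (LinearMap.lsmul R V a)).map (LinearMap.lsmul R V b) =
          (S.map (LinearMap.lsmul R V b)).map (LinearMap.lsmul R V a) := by
      intro a b S
      rw [← Submodule.map_comp, ← Submodule.map_comp]
      congr 1
      ext v
      exact smul_comm b a v
    have hK := ih (fun j ↦ x j.castSucc) D K hDK
      (by
        intro j n
        refine le_inf ((Submodule.map_mono (hKU n)).trans (hU _ _)) ?_
        rw [← Submodule.map_le_iff_le_comap, hcomm]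
        exact (Submodule.map_mono (Submodule.map_le_iff_le_comap.2 inf_le_right)).trans (hD _ _))
      (fun j n ↦ hD _ n)
      (by
        intro S h₁ h₂ h₃
        have hlast : ∀ n, (S n).map g ≤ D (n + 1) := fun n ↦
          Submodule.map_le_iff_le_comap.2 ((h₂ n).trans inf_le_right)
        have := hN S h₁ (fun n ↦ (h₂ n).trans (hKU n)) (fun j n ↦ by
          induction j using Fin.lastCases with
          | last => exact (hlast n).trans (h₁ _)
          | cast j => exact h₃ j n)
        filter_upwards [this] with n hn
        refine hn.trans (sup_le le_sup_left (iSup_le fun j ↦ ?_))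
        induction j using Fin.lastCases with
        | last => exact (hlast n).trans le_sup_left
        | cast j => exact (le_iSup (fun j : Fin r ↦
            (S n).map (LinearMap.lsmul R V (x j.castSucc))) j).trans le_sup_right)
      (by
        filter_upwards [hfin] with n hn h
        rw [e₁, h, top_add] at hn
        exact hn rfl)
    have hC := ih (fun j ↦ x j.castSucc) C (fun n ↦ U (n + 1)) hCU (fun j n ↦ hU _ _)
      (by
        intro j n
        simp only [C]
        rw [Submodule.map_sup, hcomm]
        exact sup_le_sup (hD _ _) (Submodule.map_mono (hU _ _)))
      (by
        intro S h₁ h₂ h₃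
        let S' : ℕ → Submodule R V := fun n ↦ Nat.casesOn n (D 0) S
        have hlast : ∀ n, (S n).map g ≤ C (n + 1) := fun n ↦
          (Submodule.map_mono (h₂ n)).trans le_sup_right
        have := hN S' (fun n ↦ by
            cases n with
            | zero => exact le_rfl
            | succ n => exact (hDC n).trans (h₁ n))
          (fun n ↦ by
            cases n with
            | zero => exact hDU 0
            | succ n => exact h₂ n)
          (fun j n ↦ by
            cases n with
            | zero => exact (hD _ _).trans ((hDC 0).trans (h₁ 0))
            | succ n =>
              induction j using Fin.lastCases with
              | last => exact (hlast n).trans (h₁ _)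
              | cast j => exact h₃ j n)
        filter_upwards [(Filter.tendsto_add_atTop_nat 1).eventually this] with n hn
        refine hn.trans (sup_le ((hDC _).trans le_sup_left) (iSup_le fun j ↦ ?_))
        induction j using Fin.lastCases with
        | last => exact (hlast n).trans le_sup_left
        | cast j => exact (le_iSup (fun j : Fin r ↦
            (S n).map (LinearMap.lsmul R V (x j.castSucc))) j).trans le_sup_right)
      (by
        filter_upwards [hfin'] with n hn h
        rw [e₂, h, add_top] at hn
        exact hn rfl)
    refine EventuallyPolynomial.of_sub ((hC.sub hK).congr ?_)
    filter_upwards [hfin, hfin'] with n h₁ h₂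
    rw [e₁] at h₁
    rw [e₂] at h₂
    rw [e₂, e₁, ENat.toNat_add (fun h ↦ by simp [h] at h₂) (fun h ↦ by simp [h] at h₂),
      ENat.toNat_add (fun h ↦ by simp [h] at h₁) (fun h ↦ by simp [h] at h₁)]
    push_cast
    ring

/-- The submodule of `V[X]` over the Rees algebra attached to an `I`-stable family. -/
noncomputable def reesSubmodule (I : Ideal R) (T : ℕ → Submodule R V)
    (hT : ∀ n, I • T n ≤ T (n + 1)) : Submodule (reesAlgebra I) (PolynomialModule R V) where
  carrier := { f | ∀ i, f.coeff i ∈ T i }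
  add_mem' hf hg i := Submodule.add_mem _ (hf i) (hg i)
  zero_mem' _ := Submodule.zero_mem _
  smul_mem' r f hf i := by
    have hpow : ∀ j k, I ^ j • T k ≤ T (j + k) := by
      intro j k
      induction j with
      | zero => simp
      | succ j ih =>
        rw [pow_succ', mul_smul, add_right_comm]
        exact (Submodule.smul_mono le_rfl ih).trans (hT _)
    rw [Subalgebra.smul_def, PolynomialModule.smul_apply]
    apply Submodule.sum_mem
    rintro ⟨j, k⟩ e
    rw [Finset.HasAntidiagonal.mem_antidiagonal] at e
    subst e
    exact hpow j k (Submodule.smul_mem_smul (r.2 j) (hf k))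

/-- An `I`-stable family inside `I ^ n • ⊤` is eventually generated by the previous term. -/
theorem eventually_le_smul [IsNoetherianRing R] [Module.Finite R V] (I : Ideal R)
    (S : ℕ → Submodule R V) (hS : ∀ n, S n ≤ I ^ n • ⊤) (hIS : ∀ n, I • S n ≤ S (n + 1)) :
    ∀ᶠ n in Filter.atTop, S (n + 1) ≤ I • S n := by
  let L := (I.stableFiltration (⊤ : Submodule R V)).submodule
  have hL : L.FG := (Ideal.Filtration.submodule_fg_iff_stable _
    (fun i ↦ IsNoetherian.noetherian _)).2 (I.stableFiltration_stable ⊤)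
  have : IsNoetherian (reesAlgebra I) L := isNoetherian_of_fg_of_noetherian _ hL
  let T : ℕ → ℕ → Submodule R V := fun m i ↦ I ^ (i - m) • S (min i m)
  have hT : ∀ m n, I • T m n ≤ T m (n + 1) := by
    intro m n
    simp only [T]
    rcases lt_or_ge n m with h | h
    · rw [Nat.sub_eq_zero_of_le h.le, Nat.sub_eq_zero_of_le h, min_eq_left h.le, min_eq_left h]
      simpa using hIS n
    · rw [min_eq_right h, min_eq_right (h.trans n.le_succ), Nat.sub_add_comm h, pow_succ',
        mul_smul]
  have hpow : ∀ j k, I ^ j • S k ≤ S (j + k) := by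
    intro j k
    induction j with
    | zero => simp
    | succ j ih =>
      rw [pow_succ', mul_smul, add_right_comm]
      exact (Submodule.smul_mono le_rfl ih).trans (hIS _)
  have hmono : ∀ i, Monotone fun m ↦ T m i := by
    intro i
    refine monotone_nat_of_le_succ fun m ↦ ?_
    simp only [T]
    rcases lt_or_ge m i with h | h
    · obtain ⟨k, rfl⟩ : ∃ k, i = m + 1 + k := ⟨i - (m + 1), by omega⟩
      rw [min_eq_right h.le, min_eq_right (by omega), show m + 1 + k - m = k + 1 by omega,
        show m + 1 + k - (m + 1) = k by omega, pow_succ, mul_smul]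
      exact Submodule.smul_mono le_rfl (hIS m)
    · rw [Nat.sub_eq_zero_of_le h, Nat.sub_eq_zero_of_le (h.trans m.le_succ), min_eq_left h,
        min_eq_left (h.trans m.le_succ)]
  have hTS : ∀ m i, T m i ≤ S i := fun m i ↦ (hpow _ _).trans_eq (by congr 1; omega)
  let U : ℕ →o Submodule (reesAlgebra I) L :=
    ⟨fun m ↦ (reesSubmodule I (T m) (hT m)).comap L.subtype,
      fun a b hab f hf i ↦ hmono i hab (hf i)⟩
  obtain ⟨m, hm⟩ := monotone_stabilizes_iff_noetherian.2 this U
  filter_upwards [Filter.eventually_ge_atTop m] with n hn v hv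
  have hmem : PolynomialModule.single R (n + 1) v ∈ L := by
    intro i
    by_cases h : n + 1 = i
    · subst h
      simpa using hS _ hv
    · simp [h]
  have h₁ : (⟨_, hmem⟩ : L) ∈ U (n + 1) := by
    intro i
    by_cases h : n + 1 = i
    · subst h
      simpa [T] using hv
    · simp [h]
  rw [← hm (n + 1) (by omega), hm n hn] at h₁
  have := h₁ (n + 1)
  simpa [T] using this

/-- The length of `(Q + I ^ n W') / (Q + I ^ n W'')` is eventually polynomial in `n`. -/
theorem eventuallyPolynomial_relLength_smul [IsNoetherianRing R] [Module.Finite R V] (I : Ideal R)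
    (Q W' W'' : Submodule R V) (hW : W'' ≤ W')
    (hfin : ∀ᶠ n in Filter.atTop, relLength (Q ⊔ I ^ n • W'') (Q ⊔ I ^ n • W') ≠ ⊤) :
    EventuallyPolynomial fun n ↦
      ((relLength (Q ⊔ I ^ n • W'') (Q ⊔ I ^ n • W')).toNat : ℚ) := by
  obtain ⟨r, x, hx⟩ := Submodule.fg_iff_exists_fin_generating_family.1 (IsNoetherian.noetherian I)
  have hxI : ∀ j, x j ∈ I := fun j ↦ hx ▸ Submodule.subset_span ⟨j, rfl⟩
  have hle : ∀ j (S : Submodule R V), S.map (LinearMap.lsmul R V (x j)) ≤ I • S := by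
    rintro j S _ ⟨s, hs, rfl⟩
    exact Submodule.smul_mem_smul (hxI j) hs
  have hI : ∀ S : Submodule R V, I • S ≤ ⨆ j, S.map (LinearMap.lsmul R V (x j)) := by
    intro S
    rw [Submodule.smul_le]
    intro a ha s hs
    rw [← hx] at ha
    induction ha using Submodule.span_induction with
    | mem a ha =>
      obtain ⟨j, rfl⟩ := ha
      exact Submodule.mem_iSup_of_mem j ⟨s, hs, rfl⟩
    | zero => simp
    | add a b _ _ ha hb => rw [add_smul]; exact add_mem ha hb
    | smul c a _ ha => rw [smul_assoc]; exact Submodule.smul_mem _ _ ha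
  have hstep : ∀ j n (W : Submodule R V), (Q ⊔ I ^ n • W).map (LinearMap.lsmul R V (x j)) ≤
      Q ⊔ I ^ (n + 1) • W := by
    intro j n W
    rw [Submodule.map_sup, pow_succ', mul_smul]
    refine sup_le_sup ?_ (hle _ _)
    rintro _ ⟨s, hs, rfl⟩
    exact Q.smul_mem _ hs
  refine eventuallyPolynomial_relLength r x _ _
    (fun n ↦ sup_le_sup_left (Submodule.smul_mono le_rfl hW) _)
    (fun j n ↦ hstep j n W') (fun j n ↦ hstep j n W'') ?_ hfin
  intro S h₁ h₂ h₃
  have hS : ∀ n, S n = Q ⊔ S n ⊓ I ^ n • W' := by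
    intro n
    rw [inf_comm, ← sup_inf_assoc_of_le _ (le_sup_left.trans (h₁ n)), inf_eq_right.2 (h₂ n)]
  have hIS : ∀ n, I • S n ≤ S (n + 1) := fun n ↦ (hI _).trans (iSup_le fun j ↦ h₃ j n)
  filter_upwards [eventually_le_smul I (fun n ↦ S n ⊓ I ^ n • W')
    (fun n ↦ inf_le_right.trans (Submodule.smul_mono le_rfl le_top))
    (fun n ↦ le_inf ((Submodule.smul_mono le_rfl inf_le_left).trans (hIS n)) (by
      rw [pow_succ', mul_smul]
      exact Submodule.smul_mono le_rfl inf_le_right))] with n hn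
  rw [hS (n + 1)]
  exact sup_le_sup le_sup_left (hn.trans ((Submodule.smul_mono le_rfl inf_le_left).trans (hI _)))

end Hilbert

section Complex

variable {R F₁ F₂ F₃ : Type*} [CommRing R] [IsNoetherianRing R]
  [AddCommGroup F₁] [Module R F₁] [AddCommGroup F₂] [Module R F₂] [AddCommGroup F₃] [Module R F₃]
  [Module.Finite R F₂] [Module.Finite R F₃]

theorem eventuallyPolynomial_relLength_sup_pow_smul (I : Ideal R) (Q Z : Submodule R F₂)
    (hQ : Q ≤ Z)
    (hfin : ∀ᶠ n in Filter.atTop,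
      relLength (Q ⊔ (I ^ n • ⊤ : Submodule R F₂)) (Q ⊔ I ^ n • ⊤ ⊔ Z) ≠ ⊤) :
    EventuallyPolynomial fun n ↦
      ((relLength (Q ⊔ (I ^ n • ⊤ : Submodule R F₂)) (Q ⊔ I ^ n • ⊤ ⊔ Z)).toNat : ℚ) := by
  obtain ⟨c, hc⟩ := Ideal.exists_pow_inf_eq_pow_smul I Z
  let W : Submodule R F₂ := I ^ c • ⊤ ⊓ Z
  have hWZ : W ≤ Z := inf_le_right
  have key : ∀ n, relLength (Q ⊔ (I ^ (n + c) • ⊤ : Submodule R F₂)) (Q ⊔ I ^ (n + c) • ⊤ ⊔ Z) =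
      relLength (Q ⊔ I ^ n • W) Z := by
    intro n
    rw [relLength_sup, ← relLength_inf, inf_comm, sup_inf_assoc_of_le _ hQ, hc (n + c) (by omega),
      Nat.add_sub_cancel]
  have hfin' : ∀ᶠ n in Filter.atTop, relLength (Q ⊔ I ^ n • W) Z ≠ ⊤ := by
    filter_upwards [(Filter.tendsto_add_atTop_nat c).eventually hfin] with n hn
    rwa [← key]
  refine EventuallyPolynomial.of_shift c ?_
  simp only [key]
  have hle : ∀ n, Q ⊔ I ^ (n + 1) • W ≤ Q ⊔ I ^ n • W := fun n ↦
    sup_le_sup_left (Submodule.smul_mono (Ideal.pow_le_pow_right n.le_succ) le_rfl) _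
  have hle' : ∀ n, Q ⊔ I ^ n • W ≤ Z := fun n ↦
    sup_le hQ (Submodule.smul_le_right.trans hWZ)
  have hadd : ∀ n, relLength (Q ⊔ I ^ (n + 1) • W) Z =
      relLength (Q ⊔ I ^ n • I • W) (Q ⊔ I ^ n • W) + relLength (Q ⊔ I ^ n • W) Z := by
    intro n
    rw [relLength_add (hle n) (hle' n), ← mul_smul, ← pow_succ]
  have hfin₁ : ∀ᶠ n in Filter.atTop,
      relLength (Q ⊔ I ^ n • I • W) (Q ⊔ I ^ n • W) ≠ ⊤ := by
    filter_upwards [(Filter.tendsto_add_atTop_nat 1).eventually hfin'] with n hn h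
    rw [hadd, h, top_add] at hn
    exact hn rfl
  refine EventuallyPolynomial.of_sub ((eventuallyPolynomial_relLength_smul I Q W (I • W)
    Submodule.smul_le_right hfin₁).congr ?_)
  filter_upwards [hfin', hfin₁] with n h₁ h₂
  rw [hadd, ENat.toNat_add h₂ h₁]
  push_cast
  ring

/-- The homology of `F₁/IⁿF₁ → F₂/IⁿF₂ → F₃/IⁿF₃` has eventually polynomial length. -/
theorem eventuallyPolynomial_relLength_complex (I : Ideal R) (A : F₁ →ₗ[R] F₂) (A' : F₂ →ₗ[R] F₃)
    (hA : A' ∘ₗ A = 0)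
    (hfin : ∀ᶠ n in Filter.atTop, relLength (LinearMap.range A ⊔ (I ^ n • ⊤ : Submodule R F₂))
      ((I ^ n • ⊤ : Submodule R F₃).comap A') ≠ ⊤) :
    EventuallyPolynomial fun n ↦
      ((relLength (LinearMap.range A ⊔ (I ^ n • ⊤ : Submodule R F₂))
        ((I ^ n • ⊤ : Submodule R F₃).comap A')).toNat : ℚ) := by
  set Q := LinearMap.range A with hQdef
  set Z := LinearMap.ker A' with hZdef
  have hQ : Q ≤ Z := by
    rintro _ ⟨x, rfl⟩
    exact LinearMap.congr_fun hA x
  have hmap : ∀ n, (I ^ n • ⊤ : Submodule R F₂).map A' = I ^ n • LinearMap.range A' := by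
    intro n
    rw [Submodule.map_smul'', Submodule.map_top]
  have hBZ : ∀ n, Q ⊔ (I ^ n • ⊤ : Submodule R F₂) ⊔ Z ≤
      (I ^ n • ⊤ : Submodule R F₃).comap A' := by
    intro n
    refine sup_le (sup_le (hQ.trans ?_) ?_) ?_
    · exact LinearMap.ker_le_comap _
    · rw [← Submodule.map_le_iff_le_comap, hmap]
      exact Submodule.smul_mono le_rfl le_top
    · exact LinearMap.ker_le_comap _
  have hadd := fun n ↦ relLength_add (D := Q ⊔ (I ^ n • ⊤ : Submodule R F₂)) le_sup_left (hBZ n)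
  have hfin₁ : ∀ᶠ n in Filter.atTop,
      relLength (Q ⊔ (I ^ n • ⊤ : Submodule R F₂)) (Q ⊔ I ^ n • ⊤ ⊔ Z) ≠ ⊤ := by
    filter_upwards [hfin] with n hn h
    rw [hadd, h, top_add] at hn
    exact hn rfl
  have hfin₂ : ∀ᶠ n in Filter.atTop, relLength (Q ⊔ (I ^ n • ⊤ : Submodule R F₂) ⊔ Z)
      ((I ^ n • ⊤ : Submodule R F₃).comap A') ≠ ⊤ := by
    filter_upwards [hfin] with n hn h
    rw [hadd, h, add_top] at hn
    exact hn rfl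
  obtain ⟨c, hc⟩ := Ideal.exists_pow_inf_eq_pow_smul I (LinearMap.range A')
  let W : Submodule R F₃ := I ^ c • ⊤ ⊓ LinearMap.range A'
  have hW : I ^ c • LinearMap.range A' ≤ W :=
    le_inf (Submodule.smul_mono le_rfl le_top) Submodule.smul_le_right
  have key : ∀ n, relLength (Q ⊔ (I ^ (n + c) • ⊤ : Submodule R F₂) ⊔ Z)
      ((I ^ (n + c) • ⊤ : Submodule R F₃).comap A') =
      relLength (⊥ ⊔ I ^ n • I ^ c • LinearMap.range A') (⊥ ⊔ I ^ n • W) := by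
    intro n
    have hB : Q ⊔ (I ^ (n + c) • ⊤ : Submodule R F₂) ⊔ Z =
        (I ^ (n + c) • LinearMap.range A').comap A' := by
      rw [← hmap, Submodule.comap_map_eq, sup_assoc, sup_eq_right.2]
      exact hQ.trans le_sup_right
    rw [relLength_map A' _ (I ^ (n + c) • LinearMap.range A') _ (by rw [hB]),
      Submodule.map_comap_eq,
      inf_comm, hc (n + c) (by omega), Nat.add_sub_cancel, sup_eq_right.2, bot_sup_eq, bot_sup_eq,
      ← mul_smul, ← pow_add]
    rw [pow_add, mul_smul]
    exact Submodule.smul_mono le_rfl hW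
  have h₂ : EventuallyPolynomial fun n ↦ ((relLength (Q ⊔ (I ^ n • ⊤ : Submodule R F₂) ⊔ Z)
      ((I ^ n • ⊤ : Submodule R F₃).comap A')).toNat : ℚ) := by
    refine EventuallyPolynomial.of_shift c ?_
    simp only [key]
    refine eventuallyPolynomial_relLength_smul I ⊥ W _ hW ?_
    filter_upwards [(Filter.tendsto_add_atTop_nat c).eventually hfin₂] with n hn
    rwa [← key]
  refine ((eventuallyPolynomial_relLength_sup_pow_smul I Q Z hQ hfin₁).add h₂).congr ?_
  filter_upwards [hfin₁, hfin₂] with n h₁ h₂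
  rw [hadd, ENat.toNat_add h₁ h₂]
  push_cast
  ring

end Complex

/-! ### Matlis duality -/

section Injective

variable {R : Type u} [CommRing R] {E : Type u} [AddCommGroup E] [Module R E]
  [hE : Module.Injective R E]

/-- A map into an injective module extends along a map whose kernel it kills. -/
theorem Module.Injective.exists_comp_eq_of_ker_le {A B : Type u} [AddCommGroup A] [Module R A]
    [AddCommGroup B] [Module R B] (a : A →ₗ[R] B) (c : A →ₗ[R] E)
    (h : LinearMap.ker a ≤ LinearMap.ker c) : ∃ b : B →ₗ[R] E, ∀ x, b (a x) = c x := by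
  obtain ⟨b, hb⟩ := hE.out ((LinearMap.ker a).liftQ a le_rfl)
    (LinearMap.ker_eq_bot.1 (Submodule.ker_liftQ_eq_bot _ _ _ le_rfl)) ((LinearMap.ker a).liftQ c h)
  exact ⟨b, fun x ↦ by simpa using hb (Submodule.Quotient.mk x)⟩

end Injective

/-- Every element of the module is killed by a power of the ideal `J`. -/
def IsPowerTorsion {R : Type*} (X : Type*) [CommRing R] [AddCommGroup X] [Module R X]
    (J : Ideal R) : Prop :=
  ∀ x : X, ∃ t : ℕ, ∀ a ∈ J ^ t, a • x = 0

/-- `E` is an injective module in which the residue field is an essential submodule. -/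
class IsResidueHull (R : Type u) [CommRing R] [IsLocalRing R] (E : Type u) [AddCommGroup E]
    [Module R E] : Prop extends Module.Injective R E where
  exists_embedding : ∃ f : (R ⧸ IsLocalRing.maximalIdeal R) →ₗ[R] E, Function.Injective f ∧
    ∀ S : Submodule R E, S ≠ ⊥ → S ⊓ LinearMap.range f ≠ ⊥

/-- The evaluation map into the double Matlis dual is surjective. -/
def MatlisReflexive (R E X : Type u) [CommRing R] [AddCommGroup E] [Module R E]
    [AddCommGroup X] [Module R X] : Prop :=
  Function.Surjective (matlisEval R X E)

section Matlis

open IsLocalRing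

variable {R : Type u} [CommRing R] [IsLocalRing R] {E : Type u} [AddCommGroup E] [Module R E]
  [hE : IsResidueHull R E]
  {X Y Z : Type u} [AddCommGroup X] [Module R X] [AddCommGroup Y] [Module R Y]
  [AddCommGroup Z] [Module R Z]

theorem matlisEval_apply (x : X) (φ : X →ₗ[R] E) : matlisEval R X E x φ = φ x := rfl

variable (E) in
theorem exists_apply_ne_zero (x : X) (hx : x ≠ 0) : ∃ φ : X →ₗ[R] E, φ x ≠ 0 := by
  obtain ⟨f, hf, -⟩ := hE.exists_embedding
  have hle : LinearMap.ker (LinearMap.toSpanSingleton R X x) ≤ maximalIdeal R := by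
    refine le_maximalIdeal fun h ↦ hx ?_
    have : (1 : R) ∈ LinearMap.ker (LinearMap.toSpanSingleton R X x) := h ▸ Submodule.mem_top
    simpa using this
  obtain ⟨φ, hφ⟩ := Module.Injective.exists_comp_eq_of_ker_le (E := E)
    (LinearMap.toSpanSingleton R X x) (f ∘ₗ (maximalIdeal R).mkQ) (by
      rw [LinearMap.ker_comp, LinearMap.ker_eq_bot.2 hf, Submodule.comap_bot, Submodule.ker_mkQ]
      exact hle)
  refine ⟨φ, fun h ↦ ?_⟩
  have h₁ := hφ 1
  rw [LinearMap.toSpanSingleton_apply, one_smul, h, LinearMap.comp_apply, eq_comm,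
    map_eq_zero_iff f hf, Submodule.mkQ_apply, Submodule.Quotient.mk_eq_zero] at h₁
  exact (maximalIdeal.isMaximal R).ne_top ((Ideal.eq_top_iff_one _).2 h₁)

variable (E) in
theorem exists_apply_ne_zero_of_notMem (S : Submodule R X) (x : X) (hx : x ∉ S) :
    ∃ φ : X →ₗ[R] E, (∀ s ∈ S, φ s = 0) ∧ φ x ≠ 0 := by
  obtain ⟨φ, hφ⟩ := exists_apply_ne_zero (R := R) E (S.mkQ x) (by simpa using hx)
  refine ⟨φ ∘ₗ S.mkQ, fun s hs ↦ ?_, hφ⟩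
  rw [LinearMap.comp_apply, Submodule.mkQ_apply, (Submodule.Quotient.mk_eq_zero S).2 hs, map_zero]

variable (R E) in
theorem isPowerTorsion_of_isResidueHull [IsNoetherianRing R] :
    IsPowerTorsion E (maximalIdeal R) := by
  intro e
  obtain ⟨f, hf, hess⟩ := hE.exists_embedding
  let S := Submodule.span R {e}
  obtain ⟨k, hk⟩ := Ideal.exists_pow_inf_eq_pow_smul (maximalIdeal R)
    ((LinearMap.range f).comap S.subtype)
  have hV : maximalIdeal R • (LinearMap.range f).comap S.subtype = ⊥ := by
    rw [eq_bot_iff, Submodule.smul_le]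
    rintro a ha s ⟨y, hy⟩
    obtain ⟨r, rfl⟩ := Submodule.mkQ_surjective _ y
    rw [Submodule.mem_bot, ← Subtype.coe_inj, Submodule.coe_smul, ZeroMemClass.coe_zero]
    change a • S.subtype s = 0
    rw [← hy, ← map_smul, ← map_smul, Submodule.mkQ_apply,
      (Submodule.Quotient.mk_eq_zero _).2, map_zero]
    exact Ideal.mul_mem_right _ _ ha
  have h₁ := hk (k + 1) k.le_succ
  rw [Nat.add_sub_cancel_left, pow_one, eq_bot_iff.2 ((Submodule.smul_mono le_rfl
    inf_le_right).trans hV.le)] at h₁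
  have h₂ : (maximalIdeal R ^ (k + 1) • (⊤ : Submodule R S)).map S.subtype = ⊥ := by
    by_contra h
    refine hess _ h (eq_bot_iff.2 ?_)
    rintro _ ⟨⟨s, hs, rfl⟩, hs'⟩
    have : s ∈ (⊥ : Submodule R S) := h₁ ▸ ⟨hs, hs'⟩
    simpa using this
  refine ⟨k + 1, fun a ha ↦ ?_⟩
  have : a • e ∈ (maximalIdeal R ^ (k + 1) • (⊤ : Submodule R S)).map S.subtype :=
    ⟨a • ⟨e, Submodule.mem_span_singleton_self e⟩,
      Submodule.smul_mem_smul ha Submodule.mem_top, rfl⟩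
  simpa [h₂] using this

/-- An element of the socle of `E` lies in the image of the residue field. -/
theorem mem_range_of_smul_eq_zero (f : (R ⧸ maximalIdeal R) →ₗ[R] E)
    (hess : ∀ S : Submodule R E, S ≠ ⊥ → S ⊓ LinearMap.range f ≠ ⊥) (e : E)
    (he : ∀ a ∈ maximalIdeal R, a • e = 0) : e ∈ LinearMap.range f := by
  by_cases h0 : e = 0
  · exact h0 ▸ zero_mem _
  obtain ⟨y, ⟨hy, hy'⟩, hy0⟩ := Submodule.exists_mem_ne_zero_of_ne_bot
    (hess (Submodule.span R {e}) (by simpa using h0))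
  obtain ⟨r, rfl⟩ := Submodule.mem_span_singleton.1 hy
  by_cases hr : IsUnit r
  · obtain ⟨r, rfl⟩ := hr
    simpa [smul_smul] using Submodule.smul_mem _ (↑r⁻¹ : R) hy'
  · exact (hy0 (he r hr)).elim

namespace MatlisReflexive

theorem of_surjective (g : X →ₗ[R] Y) (hg : Function.Surjective g) (h : MatlisReflexive R E X) :
    MatlisReflexive R E Y := by
  intro Φ
  obtain ⟨Ψ, hΨ⟩ := hE.out (LinearMap.lcomp R E g)
    (fun a b hab ↦ LinearMap.ext fun y ↦ by
      obtain ⟨x, rfl⟩ := hg y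
      exact LinearMap.congr_fun hab x) Φ
  obtain ⟨x, rfl⟩ := h Ψ
  exact ⟨g x, LinearMap.ext fun φ ↦ hΨ φ⟩

theorem of_injective (g : X →ₗ[R] Y) (hg : Function.Injective g) (h : MatlisReflexive R E Y) :
    MatlisReflexive R E X := by
  intro Φ
  obtain ⟨y, hy⟩ := h (Φ ∘ₗ LinearMap.lcomp R E g)
  have hy' : ∀ ψ : Y →ₗ[R] E, ψ y = Φ (ψ ∘ₗ g) := fun ψ ↦ LinearMap.congr_fun hy ψ
  have hyg : y ∈ LinearMap.range g := by
    by_contra hyg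
    obtain ⟨φ, h₁, h₂⟩ := exists_apply_ne_zero_of_notMem E _ _ hyg
    have : φ ∘ₗ g = 0 := LinearMap.ext fun x ↦ h₁ _ ⟨x, rfl⟩
    rw [hy', this, map_zero] at h₂
    exact h₂ rfl
  obtain ⟨x, rfl⟩ := hyg
  refine ⟨x, LinearMap.ext fun φ ↦ ?_⟩
  obtain ⟨ψ, hψ⟩ := hE.out g hg φ
  have : ψ ∘ₗ g = φ := LinearMap.ext hψ
  rw [matlisEval_apply, ← this, ← hy']
  rfl

theorem of_exact (g : X →ₗ[R] Y) (h : Y →ₗ[R] Z) (hh : Function.Surjective h)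
    (hgh : Function.Exact g h) (hX : MatlisReflexive R E X) (hZ : MatlisReflexive R E Z) :
    MatlisReflexive R E Y := by
  intro Φ
  obtain ⟨z, hz⟩ := hZ (Φ ∘ₗ LinearMap.lcomp R E h)
  obtain ⟨y, rfl⟩ := hh z
  have hz' : ∀ ψ : Z →ₗ[R] E, ψ (h y) = Φ (ψ ∘ₗ h) := fun ψ ↦ LinearMap.congr_fun hz ψ
  obtain ⟨Ψ, hΨ⟩ := Module.Injective.exists_comp_eq_of_ker_le (E := E)
    (LinearMap.lcomp R E g) (Φ - matlisEval R Y E y) (by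
      intro φ hφ
      have hle : LinearMap.ker h ≤ LinearMap.ker φ := by
        intro w hw
        obtain ⟨x, rfl⟩ := (hgh w).1 hw
        exact LinearMap.congr_fun hφ x
      let ψ : Z →ₗ[R] E := ((LinearMap.ker h).liftQ φ hle) ∘ₗ (h.quotKerEquivOfSurjective hh).symm
      have hψ : ψ ∘ₗ h = φ := by
        ext w
        have : (h.quotKerEquivOfSurjective hh).symm (h w) = Submodule.Quotient.mk w := by
          rw [LinearEquiv.symm_apply_eq]; rfl
        simp [ψ, this]
      rw [LinearMap.mem_ker, LinearMap.sub_apply, matlisEval_apply, sub_eq_zero, ← hψ, ← hz']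
      rfl)
  obtain ⟨x, rfl⟩ := hX Ψ
  refine ⟨g x + y, LinearMap.ext fun φ ↦ ?_⟩
  have := hΨ φ
  rw [LinearMap.sub_apply, matlisEval_apply, matlisEval_apply, eq_sub_iff_add_eq] at this
  rw [← this, matlisEval_apply, map_add]
  rfl

theorem of_subsingleton [Subsingleton X] : MatlisReflexive R E X := by
  intro Φ
  refine ⟨0, LinearMap.ext fun φ ↦ ?_⟩
  rw [Subsingleton.elim φ 0, map_zero, map_zero]

theorem pi (hX : MatlisReflexive R E X) (n : ℕ) : MatlisReflexive R E (Fin n → X) := by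
  induction n with
  | zero => exact of_subsingleton
  | succ n ih =>
    refine of_exact (LinearMap.single R (fun _ ↦ X) 0) (LinearMap.funLeft R X Fin.succ)
      (fun y ↦ ⟨Fin.cons 0 y, by ext; simp [LinearMap.funLeft_apply]⟩) (fun y ↦ ?_) hX ih
    constructor
    · intro hy
      refine ⟨y 0, ?_⟩
      ext j
      refine Fin.cases ?_ (fun j ↦ ?_) j
      · simp
      · simpa using (congrFun hy j).symm
    · rintro ⟨x, rfl⟩
      ext j
      simp [LinearMap.funLeft_apply]

variable (R E) in
theorem residue : MatlisReflexive R E (R ⧸ maximalIdeal R) := by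
  obtain ⟨f, hf, hess⟩ := hE.exists_embedding
  intro Φ
  have hk : ∀ a ∈ maximalIdeal R, ∀ x : R ⧸ maximalIdeal R, a • x = 0 := by
    intro a ha x
    obtain ⟨r, rfl⟩ := Submodule.mkQ_surjective _ x
    rw [← map_smul, Submodule.mkQ_apply, Submodule.Quotient.mk_eq_zero]
    exact Ideal.mul_mem_right _ _ ha
  have hsoc : ∀ φ : (R ⧸ maximalIdeal R) →ₗ[R] E, ∃ c : R, φ = c • f := by
    intro φ
    obtain ⟨y, hy⟩ := mem_range_of_smul_eq_zero f hess (φ (Submodule.Quotient.mk 1))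
      (fun a ha ↦ by rw [← map_smul, hk a ha, map_zero])
    obtain ⟨c, rfl⟩ := Submodule.mkQ_surjective _ y
    refine ⟨c, LinearMap.ext fun x ↦ ?_⟩
    obtain ⟨r, rfl⟩ := Submodule.mkQ_surjective _ x
    have e₁ : ∀ r : R, (maximalIdeal R).mkQ r = r • Submodule.Quotient.mk 1 := fun r ↦ by
      rw [← Submodule.mkQ_apply, ← map_smul, smul_eq_mul, mul_one]
    rw [e₁, map_smul, ← hy, e₁, map_smul, LinearMap.smul_apply, map_smul, smul_comm]
  obtain ⟨y, hy⟩ := mem_range_of_smul_eq_zero f hess (Φ f) (fun a ha ↦ by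
    rw [← map_smul, show a • f = 0 from LinearMap.ext fun x ↦ by
      rw [LinearMap.smul_apply, ← map_smul, hk a ha, map_zero, LinearMap.zero_apply], map_zero])
  refine ⟨y, LinearMap.ext fun φ ↦ ?_⟩
  obtain ⟨c, rfl⟩ := hsoc φ
  rw [matlisEval_apply, map_smul, LinearMap.smul_apply, hy]

theorem of_finite_of_smul_eq_zero [IsNoetherianRing R] (t : ℕ) {X : Type u} [AddCommGroup X]
    [Module R X] [Module.Finite R X] (h : ∀ a ∈ maximalIdeal R ^ t, ∀ x : X, a • x = 0) :
    MatlisReflexive R E X := by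
  induction t generalizing X with
  | zero =>
    have : Subsingleton X := ⟨fun x y ↦ by
      rw [← one_smul R x, ← one_smul R y, h 1 (by simp), h 1 (by simp)]⟩
    exact of_subsingleton
  | succ t ih =>
    let S : Submodule R X := maximalIdeal R • ⊤
    refine of_exact S.subtype S.mkQ S.mkQ_surjective (LinearMap.exact_subtype_mkQ S)
      (ih fun a ha x ↦ ?_) ?_
    · obtain ⟨x, hx⟩ := x
      rw [← Subtype.coe_inj]
      change a • x = 0
      refine Submodule.smul_induction_on hx (fun r hr n _ ↦ ?_) (fun x y hx hy ↦ ?_)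
      · rw [smul_smul]
        exact h _ (pow_succ (maximalIdeal R) t ▸ Ideal.mul_mem_mul ha hr) n
      · rw [smul_add, hx, hy, add_zero]
    · obtain ⟨r, g, hg⟩ := Module.Finite.exists_fin' R X
      have hle : (maximalIdeal R) • (⊤ : Submodule R (Fin r → R)) ≤
          LinearMap.ker (S.mkQ ∘ₗ g) := by
        rw [Submodule.smul_le]
        intro a ha n _
        rw [LinearMap.mem_ker, LinearMap.comp_apply, map_smul, Submodule.mkQ_apply,
          Submodule.Quotient.mk_eq_zero]
        exact Submodule.smul_mem_smul ha Submodule.mem_top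
      have hpi : MatlisReflexive R E (Fin r → R ⧸ maximalIdeal R) := (residue R E).pi r
      let p : (Fin r → R) →ₗ[R] (Fin r → R ⧸ maximalIdeal R) := (maximalIdeal R).mkQ.compLeft _
      have hp : Function.Surjective p := fun y ↦ by
        choose z hz using fun i ↦ (maximalIdeal R).mkQ_surjective (y i)
        exact ⟨z, funext hz⟩
      have hker : LinearMap.ker p ≤ LinearMap.ker (S.mkQ ∘ₗ g) := by
        refine le_trans (fun z hz ↦ ?_) hle
        have hz' : ∀ i, z i ∈ maximalIdeal R := fun i ↦ by
          have := congrFun hz i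
          simpa [p, Ideal.Quotient.eq_zero_iff_mem] using this
        rw [pi_eq_sum_univ z]
        exact Submodule.sum_mem _ fun i _ ↦
          Submodule.smul_mem_smul (hz' i) Submodule.mem_top
      refine hpi.of_surjective (((LinearMap.ker p).liftQ _ hker) ∘ₗ
        (p.quotKerEquivOfSurjective hp).symm.toLinearMap) fun y ↦ ?_
      obtain ⟨x, rfl⟩ := S.mkQ_surjective y
      obtain ⟨z, rfl⟩ := hg x
      refine ⟨p z, ?_⟩
      have : (p.quotKerEquivOfSurjective hp).symm (p z) = Submodule.Quotient.mk z := by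
        rw [LinearEquiv.symm_apply_eq]; rfl
      simp [this]

end MatlisReflexive

variable [IsNoetherianRing R] [IsAdicComplete (maximalIdeal R) R]

/-- Every endomorphism of `E` is multiplication by a ring element. -/
theorem exists_forall_eq_smul (h : E →ₗ[R] E) : ∃ r : R, ∀ e, h e = r • e := by
  have hn : ∀ n : ℕ, ∃ r : R, ∀ e : E, (∀ a ∈ maximalIdeal R ^ n, a • e = 0) → h e = r • e := by
    intro n
    have hR : MatlisReflexive R E (R ⧸ maximalIdeal R ^ n) :=
      MatlisReflexive.of_finite_of_smul_eq_zero n fun a ha x ↦ by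
        obtain ⟨r, rfl⟩ := Submodule.mkQ_surjective _ x
        rw [← map_smul, Submodule.mkQ_apply, Submodule.Quotient.mk_eq_zero]
        exact Ideal.mul_mem_right _ _ ha
    let Φ : ((R ⧸ maximalIdeal R ^ n) →ₗ[R] E) →ₗ[R] E :=
      h ∘ₗ LinearMap.applyₗ (Submodule.Quotient.mk 1)
    obtain ⟨y, hy⟩ := hR Φ
    obtain ⟨r, rfl⟩ := Submodule.mkQ_surjective _ y
    refine ⟨r, fun e he ↦ ?_⟩
    let φ := (maximalIdeal R ^ n).liftQ (LinearMap.toSpanSingleton R E e) (fun a ha ↦ by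
      simpa using he a ha)
    have := LinearMap.congr_fun hy φ
    have h₁ : φ (Submodule.Quotient.mk 1) = e := by
      simp only [φ]
      rw [Submodule.liftQ_apply, LinearMap.toSpanSingleton_apply, one_smul]
    have h₂ : φ (Submodule.Quotient.mk r) = r • e := by
      simp only [φ]
      rw [Submodule.liftQ_apply, LinearMap.toSpanSingleton_apply]
    rw [← h₂, ← h₁]
    exact this.symm
  choose r hr using hn
  have hmem : ∀ (n : ℕ) (a : R), (∀ e : E, (∀ b ∈ maximalIdeal R ^ n, b • e = 0) → a • e = 0) →
      a ∈ maximalIdeal R ^ n := by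
    intro n a ha
    by_contra hna
    obtain ⟨φ, h₁, h₂⟩ := exists_apply_ne_zero_of_notMem E (maximalIdeal R ^ n) a hna
    refine h₂ ?_
    have := ha (φ 1) fun b hb ↦ by rw [← map_smul, smul_eq_mul, mul_one, h₁ b hb]
    rwa [← map_smul, smul_eq_mul, mul_one] at this
  obtain ⟨L, hL⟩ := IsPrecomplete.prec' (I := maximalIdeal R) (M := R) r (fun {m n} hmn ↦ by
    rw [SModEq.sub_mem, smul_eq_mul, Ideal.mul_top]
    refine hmem m _ fun e he ↦ ?_
    rw [sub_smul, ← hr m e he, ← hr n e (fun b hb ↦ he b (Ideal.pow_le_pow_right hmn hb)),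
      sub_self])
  refine ⟨L, fun e ↦ ?_⟩
  obtain ⟨n, hn⟩ := isPowerTorsion_of_isResidueHull R E e
  have := hL n
  rw [SModEq.sub_mem, smul_eq_mul, Ideal.mul_top] at this
  have := hn _ this
  rw [sub_smul, sub_eq_zero] at this
  rw [hr n e hn, this]

namespace MatlisReflexive

variable (E) in
theorem of_finite [Module.Finite R X] : MatlisReflexive R E X := by
  have hR : MatlisReflexive R E R := by
    intro Φ
    obtain ⟨r, hr⟩ := exists_forall_eq_smul
      (Φ ∘ₗ (LinearMap.ringLmapEquivSelf R R E).symm.toLinearMap)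
    refine ⟨r, LinearMap.ext fun φ ↦ ?_⟩
    have := hr (φ 1)
    rw [← map_smul, smul_eq_mul, mul_one] at this
    rw [matlisEval_apply, ← this, LinearMap.comp_apply]
    congr 1
    ext
    simp
  obtain ⟨n, g, hg⟩ := Module.Finite.exists_fin' R X
  exact (hR.pi n).of_surjective g hg

variable (R E) in
theorem self : MatlisReflexive R E E := by
  intro Φ
  refine ⟨Φ LinearMap.id, LinearMap.ext fun φ ↦ ?_⟩
  obtain ⟨r, hr⟩ := exists_forall_eq_smul φ
  have : φ = r • LinearMap.id := LinearMap.ext hr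
  rw [matlisEval_apply, this, map_smul]
  rfl

end MatlisReflexive

end Matlis

section MatlisLength

open IsLocalRing

variable {R : Type u} [CommRing R] [IsLocalRing R] {E : Type u} [AddCommGroup E] [Module R E]
  [hE : IsResidueHull R E]
  {X Y Z : Type u} [AddCommGroup X] [Module R X] [AddCommGroup Y] [Module R Y]
  [AddCommGroup Z] [Module R Z]

variable (R E X) in
theorem length_le_length_dual : Module.length R X ≤ Module.length R (X →ₗ[R] E) := by
  rw [← WithBot.coe_le_coe, Module.coe_length, Module.coe_length,
    ← Order.krullDim_orderDual (α := Submodule R (X →ₗ[R] E))]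
  let F : Submodule R X → (Submodule R (X →ₗ[R] E))ᵒᵈ := fun S ↦
    OrderDual.toDual (LinearMap.ker (LinearMap.lcomp R E S.subtype))
  have hmem : ∀ S φ, φ ∈ OrderDual.ofDual (F S) ↔ ∀ s ∈ S, φ s = 0 := by
    intro S φ
    simp only [F, OrderDual.ofDual_toDual, LinearMap.mem_ker, LinearMap.lcomp_apply',
      LinearMap.ext_iff]
    exact ⟨fun h s hs ↦ h ⟨s, hs⟩, fun h s ↦ h s s.2⟩
  refine Order.krullDim_le_of_strictMono F fun S T hST ↦ ?_
  refine lt_of_le_of_ne (fun φ hφ ↦ ?_) fun h ↦ ?_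
  · exact (hmem S φ).2 fun s hs ↦ (hmem T φ).1 hφ s (hST.le hs)
  · obtain ⟨x, hxT, hxS⟩ := SetLike.exists_of_lt hST
    obtain ⟨φ, h₁, h₂⟩ := exists_apply_ne_zero_of_notMem E S x hxS
    exact h₂ ((hmem T φ).1 (h ▸ (hmem S φ).2 h₁) x hxT)

theorem MatlisReflexive.length_dual (h : MatlisReflexive R E X) :
    Module.length R (X →ₗ[R] E) = Module.length R X := by
  refine le_antisymm ((length_le_length_dual R E (X →ₗ[R] E)).trans ?_)
    (length_le_length_dual R E X)
  exact Module.length_le_of_surjective _ h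

theorem MatlisReflexive.exists_injective_pi (h : MatlisReflexive R E Y)
    (hY : ∀ a ∈ maximalIdeal R, ∀ y : Y, a • y = 0) :
    ∃ (q : ℕ) (g : Y →ₗ[R] (Fin q → E)), Function.Injective g := by
  classical
  obtain ⟨f, hf, -⟩ := hE.exists_embedding
  let K := R ⧸ maximalIdeal R
  let _ : Field K := Ideal.Quotient.field _
  have htors : Module.IsTorsionBySet R Y (maximalIdeal R : Set R) := fun y a ↦ hY a a.2 y
  let _ : Module K Y := htors.module
  have : IsScalarTower R K Y := htors.isScalarTower
  let b := Module.Basis.ofVectorSpace K Y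
  let ι := Module.Basis.ofVectorSpaceIndex K Y
  have hone : f (1 : K) ≠ 0 := by
    rw [Ne, map_eq_zero_iff f hf]
    exact one_ne_zero
  have hfin : Finite ι := by
    by_contra hinf
    let 𝓕 : Submodule R (Y →ₗ[R] E) :=
      { carrier := { φ | {i : ι | φ (b i) ≠ 0}.Finite }
        add_mem' := fun {φ ψ} hφ hψ ↦ (hφ.union hψ).subset fun i hi ↦ by
          by_contra hcon
          simp only [Set.mem_union, Set.mem_ofPred_eq, not_or, not_not] at hcon
          exact hi (by rw [LinearMap.add_apply, hcon.1, hcon.2, add_zero])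
        zero_mem' := by simp
        smul_mem' := fun c φ hφ ↦ hφ.subset fun i hi hcon ↦
          hi (by rw [LinearMap.smul_apply, hcon, smul_zero]) }
    let φ₀ : Y →ₗ[R] E := f ∘ₗ (b.constr ℕ fun _ ↦ (1 : K)).restrictScalars R
    have hφ₀ : φ₀ ∉ 𝓕 := by
      intro (h₀ : {i : ι | φ₀ (b i) ≠ 0}.Finite)
      have : {i : ι | φ₀ (b i) ≠ 0} = Set.univ := by
        ext i
        simpa [φ₀, Module.Basis.constr_basis] using hone
      rw [this, Set.finite_univ_iff] at h₀
      exact hinf h₀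
    obtain ⟨Φ, h₁, h₂⟩ := exists_apply_ne_zero_of_notMem E 𝓕 φ₀ hφ₀
    obtain ⟨y, rfl⟩ := h Φ
    refine h₂ ?_
    suffices y = 0 by rw [this, map_zero, LinearMap.zero_apply]
    refine b.repr.map_eq_zero_iff.1 (Finsupp.ext fun i ↦ ?_)
    let φ : Y →ₗ[R] E := f ∘ₗ (b.coord i).restrictScalars R
    have hφ : φ ∈ 𝓕 := by
      refine (Set.finite_singleton i).subset fun j hj ↦ ?_
      by_contra hji
      refine hj ?_
      have : b.coord i (b j) = 0 := by
        rw [Module.Basis.coord_apply, Module.Basis.repr_self, Finsupp.single_eq_of_ne' hji]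
      simp only [φ, LinearMap.comp_apply, LinearMap.restrictScalars_apply, this, map_zero]
    have := h₁ φ hφ
    rw [matlisEval_apply] at this
    simp only [φ, LinearMap.comp_apply, LinearMap.restrictScalars_apply] at this
    rw [map_eq_zero_iff f hf] at this
    exact this
  obtain ⟨q, ⟨e⟩⟩ := Finite.exists_equiv_fin ι
  refine ⟨q, LinearMap.pi fun j ↦ f ∘ₗ (b.coord (e.symm j)).restrictScalars R, ?_⟩
  rw [injective_iff_map_eq_zero]
  intro y hy
  refine b.repr.map_eq_zero_iff.1 (Finsupp.ext fun i ↦ ?_)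
  have := congrFun hy (e i)
  simp only [LinearMap.pi_apply, LinearMap.comp_apply, LinearMap.restrictScalars_apply,
    Equiv.symm_apply_apply, Pi.zero_apply] at this
  rwa [map_eq_zero_iff f hf] at this

/-- If `Hom(k, X)` is reflexive, finitely many functionals separate the points of the socle. -/
theorem exists_pi_injOn_socle (h : MatlisReflexive R E ((R ⧸ maximalIdeal R) →ₗ[R] X)) :
    ∃ (q : ℕ) (g : X →ₗ[R] (Fin q → E)),
      ∀ x, (∀ a ∈ maximalIdeal R, a • x = 0) → g x = 0 → x = 0 := by
  let Y : Submodule R X := Submodule.torsionBySet R X (maximalIdeal R : Set R)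
  have hY : ∀ x : X, x ∈ Y ↔ ∀ a ∈ maximalIdeal R, a • x = 0 := fun x ↦ by
    rw [Submodule.mem_torsionBySet_iff]
    exact ⟨fun h a ha ↦ h ⟨a, ha⟩, fun h a ↦ h a a.2⟩
  let j : Y →ₗ[R] ((R ⧸ maximalIdeal R) →ₗ[R] X) :=
    { toFun := fun y ↦ (maximalIdeal R).liftQ (LinearMap.toSpanSingleton R X y) (fun a ha ↦ by
        simpa using (hY y).1 y.2 a ha)
      map_add' := fun x y ↦ LinearMap.ext fun r ↦ by
        obtain ⟨r, rfl⟩ := Submodule.mkQ_surjective _ r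
        rw [LinearMap.add_apply, Submodule.mkQ_apply, Submodule.liftQ_apply, Submodule.liftQ_apply,
          Submodule.liftQ_apply]
        exact smul_add r (x : X) y
      map_smul' := fun c y ↦ LinearMap.ext fun r ↦ by
        obtain ⟨r, rfl⟩ := Submodule.mkQ_surjective _ r
        rw [LinearMap.smul_apply, Submodule.mkQ_apply, Submodule.liftQ_apply, Submodule.liftQ_apply]
        exact smul_comm r c (y : X) }
  have hj : Function.Injective j := by
    intro x y hxy
    have := LinearMap.congr_fun hxy (Submodule.Quotient.mk 1)
    simp only [j, LinearMap.coe_mk, AddHom.coe_mk] at this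
    rw [Submodule.liftQ_apply, Submodule.liftQ_apply] at this
    simpa using this
  obtain ⟨q, g, hg⟩ := (h.of_injective j hj).exists_injective_pi (fun a ha y ↦ by
    rw [← Subtype.coe_inj]
    exact (hY y).1 y.2 a ha)
  obtain ⟨G, hG⟩ := Module.Injective.out Y.subtype Y.injective_subtype g
  refine ⟨q, G, fun x hx h0 ↦ ?_⟩
  have := hG ⟨x, (hY x).2 hx⟩
  rw [Submodule.subtype_apply, h0, eq_comm, map_eq_zero_iff g hg] at this
  exact congrArg Subtype.val this

end MatlisLength

/-! ### Cohomology of `Hom` complexes -/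

section HomCohomology

variable {R : Type u} [CommRing R]
  {A₃ A₂ A₁ A₀ : Type u} [AddCommGroup A₃] [Module R A₃] [AddCommGroup A₂] [Module R A₂]
  [AddCommGroup A₁] [Module R A₁] [AddCommGroup A₀] [Module R A₀]
  {X J X' : Type u} [AddCommGroup X] [Module R X] [AddCommGroup J] [Module R J]
  [AddCommGroup X'] [Module R X']

/-- The factorization of a linear map through an injective map containing its range. -/
noncomputable def LinearMap.factorInjective (ι : X →ₗ[R] J) (hι : Function.Injective ι)
    (ψ : A₀ →ₗ[R] J) (h : ∀ x, ψ x ∈ LinearMap.range ι) : A₀ →ₗ[R] X :=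
  (LinearEquiv.ofInjective ι hι).symm.toLinearMap ∘ₗ ψ.codRestrict (LinearMap.range ι) h

theorem LinearMap.apply_factorInjective (ι : X →ₗ[R] J) (hι : Function.Injective ι)
    (ψ : A₀ →ₗ[R] J) (h : ∀ x, ψ x ∈ LinearMap.range ι) (x : A₀) :
    ι (LinearMap.factorInjective ι hι ψ h x) = ψ x :=
  congrArg Subtype.val ((LinearEquiv.ofInjective ι hι).apply_symm_apply ⟨ψ x, h x⟩)

/-- The cohomology at `Hom(A₁, X)` of the complex `Hom(A₀, X) → Hom(A₁, X) → Hom(A₂, X)`. -/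
abbrev HomCohomology (d₂ : A₂ →ₗ[R] A₁) (d₁ : A₁ →ₗ[R] A₀) (X : Type u) [AddCommGroup X]
    [Module R X] : Type u :=
  LinearMap.ker (LinearMap.lcomp R X d₂) ⧸
    (LinearMap.range (LinearMap.lcomp R X d₁)).comap
      (LinearMap.ker (LinearMap.lcomp R X d₂)).subtype

/-- Dimension shifting along a short exact sequence `0 → X → J → X' → 0` with `J` injective. -/
theorem exists_connecting_hom [Module.Injective R J] [Module.Projective R A₁]
    (d₃ : A₃ →ₗ[R] A₂) (d₂ : A₂ →ₗ[R] A₁) (d₁ : A₁ →ₗ[R] A₀)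
    (h₃ : Function.Exact d₃ d₂) (h₂ : Function.Exact d₂ d₁)
    (ι : X →ₗ[R] J) (π : J →ₗ[R] X') (hι : Function.Injective ι) (hπ : Function.Surjective π)
    (hιπ : Function.Exact ι π) :
    ∃ δ : LinearMap.ker (LinearMap.lcomp R X' d₂) →ₗ[R] HomCohomology d₃ d₂ X,
      Function.Surjective δ ∧ ∀ z, δ z = 0 ↔
        ∃ ν : A₀ →ₗ[R] J, (z : A₁ →ₗ[R] X') = π ∘ₗ ν ∘ₗ d₁ := by
  let T : Submodule R (A₁ →ₗ[R] J) :=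
    (LinearMap.ker (LinearMap.lcomp R X' d₂)).comap (LinearMap.llcomp R A₁ J X' π)
  have hT : ∀ ψ : A₁ →ₗ[R] J, ψ ∈ T ↔ ∀ x, π (ψ (d₂ x)) = 0 := fun ψ ↦ LinearMap.ext_iff
  let α : T →ₗ[R] LinearMap.ker (LinearMap.lcomp R X' d₂) :=
    (LinearMap.llcomp R A₁ J X' π).restrict fun ψ hψ ↦ hψ
  have hα : Function.Surjective α := by
    rintro ⟨φ, hφ⟩
    obtain ⟨ψ, rfl⟩ := Module.projective_lifting_property π φ hπ
    exact ⟨⟨ψ, hφ⟩, rfl⟩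
  let β₁ : T → (A₂ →ₗ[R] X) := fun ψ ↦ LinearMap.factorInjective ι hι ((ψ : A₁ →ₗ[R] J) ∘ₗ d₂)
    (fun x ↦ (hιπ _).1 ((hT _).1 ψ.2 x))
  have hβ₁ : ∀ (ψ : T) x, ι (β₁ ψ x) = (ψ : A₁ →ₗ[R] J) (d₂ x) := fun ψ x ↦
    LinearMap.apply_factorInjective ι hι _ _ x
  let β₀ : T →ₗ[R] LinearMap.ker (LinearMap.lcomp R X d₃) :=
    { toFun := fun ψ ↦ ⟨β₁ ψ, by
        rw [LinearMap.mem_ker]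
        ext x
        refine hι ((hβ₁ _ _).trans ?_)
        simp [(h₃ _).2 ⟨x, rfl⟩]⟩
      map_add' := fun ψ ψ' ↦ Subtype.ext (LinearMap.ext fun x ↦ hι (by
        rw [hβ₁]
        change _ = ι (β₁ ψ x + β₁ ψ' x)
        rw [map_add, hβ₁, hβ₁]
        rfl))
      map_smul' := fun c ψ ↦ Subtype.ext (LinearMap.ext fun x ↦ hι (by
        rw [hβ₁]
        change _ = ι (c • β₁ ψ x)
        rw [map_smul, hβ₁]
        rfl)) }
  have hβ₀ : ∀ (ψ : T) x, ι ((β₀ ψ : A₂ →ₗ[R] X) x) = (ψ : A₁ →ₗ[R] J) (d₂ x) := hβ₁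
  let β : T →ₗ[R] HomCohomology d₃ d₂ X := Submodule.mkQ _ ∘ₗ β₀
  have hβ : Function.Surjective β := by
    refine (Submodule.mkQ_surjective _).comp ?_
    rintro ⟨χ, hχ⟩
    obtain ⟨ψ, hψ⟩ := Module.Injective.exists_comp_eq_of_ker_le (E := J) d₂ (ι ∘ₗ χ) (by
      intro x hx
      obtain ⟨y, rfl⟩ := (h₃ x).1 hx
      have : χ (d₃ y) = 0 := LinearMap.congr_fun hχ y
      simp [this])
    have hψT : ψ ∈ T := (hT ψ).2 fun x ↦ by
      rw [hψ]
      exact (hιπ _).2 ⟨_, rfl⟩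
    refine ⟨⟨ψ, hψT⟩, Subtype.ext (LinearMap.ext fun x ↦ hι ?_)⟩
    rw [hβ₀]
    exact hψ x
  have hβ0 : ∀ ψ : T, β ψ = 0 ↔ ∃ ξ : A₁ →ₗ[R] X, ∀ x, (ψ : A₁ →ₗ[R] J) (d₂ x) = ι (ξ (d₂ x)) := by
    intro ψ
    rw [LinearMap.comp_apply, Submodule.mkQ_apply, Submodule.Quotient.mk_eq_zero]
    refine exists_congr fun ξ ↦ ?_
    rw [LinearMap.ext_iff]
    refine forall_congr' fun x ↦ ?_
    rw [← hβ₀]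
    exact ⟨fun h ↦ congrArg ι h.symm, fun h ↦ (hι h).symm⟩
  have hα0 : ∀ ψ : A₁ →ₗ[R] J, (∀ x, π (ψ x) = 0) → ∃ ξ : A₁ →ₗ[R] X, ∀ x, ψ x = ι (ξ x) := by
    intro ψ hψ
    exact ⟨LinearMap.factorInjective ι hι ψ fun x ↦ (hιπ _).1 (hψ x),
      fun x ↦ (LinearMap.apply_factorInjective ι hι ψ _ x).symm⟩
  have hker : LinearMap.ker α ≤ LinearMap.ker β := by
    intro ψ hψ
    obtain ⟨ξ, hξ⟩ := hα0 ψ fun x ↦ LinearMap.congr_fun (congrArg Subtype.val hψ) x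
    exact (hβ0 ψ).2 ⟨ξ, fun x ↦ hξ _⟩
  let δ : LinearMap.ker (LinearMap.lcomp R X' d₂) →ₗ[R] HomCohomology d₃ d₂ X :=
    (LinearMap.ker α).liftQ β hker ∘ₗ (α.quotKerEquivOfSurjective hα).symm.toLinearMap
  have hδ : ∀ ψ, δ (α ψ) = β ψ := by
    intro ψ
    have : (α.quotKerEquivOfSurjective hα).symm (α ψ) = Submodule.Quotient.mk ψ := by
      rw [LinearEquiv.symm_apply_eq]; rfl
    simp only [δ, LinearMap.comp_apply, LinearEquiv.coe_coe, this]
    rw [Submodule.liftQ_apply]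
  refine ⟨δ, fun y ↦ ?_, fun z ↦ ?_⟩
  · obtain ⟨ψ, rfl⟩ := hβ y
    exact ⟨α ψ, hδ ψ⟩
  · obtain ⟨ψ, rfl⟩ := hα z
    rw [hδ, hβ0]
    constructor
    · rintro ⟨ξ, hξ⟩
      obtain ⟨ν, hν⟩ := Module.Injective.exists_comp_eq_of_ker_le (E := J) d₁
        ((ψ : A₁ →ₗ[R] J) - ι ∘ₗ ξ) (by
          intro x hx
          obtain ⟨y, rfl⟩ := (h₂ x).1 hx
          simp [hξ])
      refine ⟨ν, LinearMap.ext fun x ↦ ?_⟩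
      change π ((ψ : A₁ →ₗ[R] J) x) = π (ν (d₁ x))
      rw [hν, LinearMap.sub_apply, map_sub, LinearMap.comp_apply, (hιπ _).2 ⟨ξ x, rfl⟩, sub_zero]
    · rintro ⟨ν, hν⟩
      obtain ⟨ξ, hξ⟩ := hα0 ((ψ : A₁ →ₗ[R] J) - ν ∘ₗ d₁) fun x ↦ by
        have : π ((ψ : A₁ →ₗ[R] J) x) = π (ν (d₁ x)) := LinearMap.congr_fun hν x
        simp [this]
      refine ⟨ξ, fun x ↦ ?_⟩
      rw [← hξ, LinearMap.sub_apply, LinearMap.comp_apply, (h₂ _).2 ⟨x, rfl⟩, map_zero, sub_zero]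

/-- Dimension shifting in higher degrees. -/
theorem nonempty_homCohomology_equiv [Module.Injective R J] [Module.Projective R A₁]
    [Module.Projective R A₀] (d₃ : A₃ →ₗ[R] A₂) (d₂ : A₂ →ₗ[R] A₁) (d₁ : A₁ →ₗ[R] A₀)
    (h₃ : Function.Exact d₃ d₂) (h₂ : Function.Exact d₂ d₁)
    (ι : X →ₗ[R] J) (π : J →ₗ[R] X') (hι : Function.Injective ι) (hπ : Function.Surjective π)
    (hιπ : Function.Exact ι π) :
    Nonempty (HomCohomology d₂ d₁ X' ≃ₗ[R] HomCohomology d₃ d₂ X) := by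
  obtain ⟨δ, hδ, hδ0⟩ := exists_connecting_hom d₃ d₂ d₁ h₃ h₂ ι π hι hπ hιπ
  refine ⟨(Submodule.quotEquivOfEq _ _ ?_).trans (δ.quotKerEquivOfSurjective hδ)⟩
  ext z
  rw [LinearMap.mem_ker, hδ0]
  constructor
  · rintro ⟨φ, hφ⟩
    obtain ⟨ν, rfl⟩ := Module.projective_lifting_property π φ hπ
    exact ⟨ν, hφ.symm⟩
  · rintro ⟨ν, hν⟩
    exact ⟨π ∘ₗ ν, hν.symm⟩

/-- Dimension shifting in degree one, for `A₃ → A₂ → A₁ → B → 0` exact. -/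
theorem exists_connecting_hom_of_surjective {B : Type u} [AddCommGroup B] [Module R B]
    [Module.Injective R J] [Module.Projective R A₁]
    (d₃ : A₃ →ₗ[R] A₂) (d₂ : A₂ →ₗ[R] A₁) (ε : A₁ →ₗ[R] B)
    (h₃ : Function.Exact d₃ d₂) (h₂ : Function.Exact d₂ ε) (hε : Function.Surjective ε)
    (ι : X →ₗ[R] J) (π : J →ₗ[R] X') (hι : Function.Injective ι) (hπ : Function.Surjective π)
    (hιπ : Function.Exact ι π) :
    ∃ δ : (B →ₗ[R] X') →ₗ[R] HomCohomology d₃ d₂ X,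
      Function.Surjective δ ∧ ∀ z, δ z = 0 ↔ ∃ ν : B →ₗ[R] J, π ∘ₗ ν = z := by
  obtain ⟨δ, hδ, hδ0⟩ := exists_connecting_hom d₃ d₂ ε h₃ h₂ ι π hι hπ hιπ
  let γ : (B →ₗ[R] X') →ₗ[R] LinearMap.ker (LinearMap.lcomp R X' d₂) :=
    LinearMap.codRestrict _ (LinearMap.lcomp R X' ε) fun φ ↦ by
      rw [LinearMap.mem_ker]
      ext x
      simp [(h₂ _).2 ⟨x, rfl⟩]
  have hγ : Function.Surjective γ := by
    rintro ⟨φ, hφ⟩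
    have hle : LinearMap.ker ε ≤ LinearMap.ker φ := fun x hx ↦ by
      obtain ⟨y, rfl⟩ := (h₂ x).1 hx
      exact LinearMap.congr_fun hφ y
    refine ⟨(LinearMap.ker ε).liftQ φ hle ∘ₗ (ε.quotKerEquivOfSurjective hε).symm.toLinearMap,
      Subtype.ext (LinearMap.ext fun x ↦ ?_)⟩
    have : (ε.quotKerEquivOfSurjective hε).symm (ε x) = Submodule.Quotient.mk x := by
      rw [LinearEquiv.symm_apply_eq]; rfl
    change (LinearMap.ker ε).liftQ φ hle ((ε.quotKerEquivOfSurjective hε).symm (ε x)) = φ x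
    rw [this, Submodule.liftQ_apply]
  refine ⟨δ ∘ₗ γ, hδ.comp hγ, fun z ↦ ?_⟩
  rw [LinearMap.comp_apply, hδ0]
  refine exists_congr fun ν ↦ ?_
  constructor
  · intro h
    ext b
    obtain ⟨x, rfl⟩ := hε b
    exact (LinearMap.congr_fun h x).symm
  · rintro rfl
    rfl

end HomCohomology

/-! ### Resolutions by finite free modules and `Ext` -/

/-- A resolution of a module by finite free modules. -/
structure FreeRes (R : Type u) [CommRing R] (B : Type u) [AddCommGroup B] [Module R B] where
  /-- The ranks of the free modules. -/
  r : ℕ → ℕ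
  /-- The differentials. -/
  d (j : ℕ) : (Fin (r (j + 1)) → R) →ₗ[R] (Fin (r j) → R)
  /-- The augmentation. -/
  ε : (Fin (r 0) → R) →ₗ[R] B
  surjective_ε : Function.Surjective ε
  exact_ε : Function.Exact (d 0) ε
  exact_d (j : ℕ) : Function.Exact (d (j + 1)) (d j)

section FreeRes

variable (R : Type u) [CommRing R] [IsNoetherianRing R]

theorem exists_linearMap_range_eq {n : ℕ} (K : Submodule R (Fin n → R)) :
    ∃ (m : ℕ) (g : (Fin m → R) →ₗ[R] (Fin n → R)), LinearMap.range g = K := by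
  obtain ⟨m, g, hg⟩ := Module.Finite.exists_fin' R K
  exact ⟨m, K.subtype ∘ₗ g, by
    rw [LinearMap.range_comp, LinearMap.range_eq_top.2 hg, Submodule.map_top,
      Submodule.range_subtype]⟩

/-- The successive syzygies of a submodule of a finite free module. -/
noncomputable def syzygy (K₀ : Σ n : ℕ, Submodule R (Fin n → R)) :
    ℕ → Σ n : ℕ, Submodule R (Fin n → R)
  | 0 => K₀
  | j + 1 => ⟨(exists_linearMap_range_eq R (syzygy K₀ j).2).choose,
      LinearMap.ker (exists_linearMap_range_eq R (syzygy K₀ j).2).choose_spec.choose⟩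

theorem FreeRes.nonempty (B : Type u) [AddCommGroup B] [Module R B] [Module.Finite R B] :
    Nonempty (FreeRes R B) := by
  obtain ⟨n, ε, hε⟩ := Module.Finite.exists_fin' R B
  let s := syzygy R ⟨n, LinearMap.ker ε⟩
  refine ⟨⟨fun j ↦ (s j).1,
    fun j ↦ (exists_linearMap_range_eq R (s j).2).choose_spec.choose, ε, hε, ?_, fun j ↦ ?_⟩⟩
  · exact fun x ↦ (SetLike.ext_iff.1
      (exists_linearMap_range_eq R (s 0).2).choose_spec.choose_spec x).symm
  · exact fun x ↦ (SetLike.ext_iff.1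
      (exists_linearMap_range_eq R (s (j + 1)).2).choose_spec.choose_spec x).symm

end FreeRes

namespace FreeRes

variable {R : Type u} [CommRing R] {B : Type u} [AddCommGroup B] [Module R B] (P : FreeRes R B)

/-- The chain complex of a finite free resolution. -/
noncomputable def complex : ChainComplex (ModuleCat.{u} R) ℕ :=
  ChainComplex.of (fun j ↦ ModuleCat.of R (Fin (P.r j) → R)) (fun j ↦ ModuleCat.ofHom (P.d j))
    fun j ↦ by
      rw [← ModuleCat.ofHom_comp]
      exact congrArg ModuleCat.ofHom (P.exact_d j).linearMap_comp_eq_zero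

theorem complex_d (j : ℕ) : P.complex.d (j + 1) j = ModuleCat.ofHom (P.d j) :=
  ChainComplex.of_d (fun j ↦ ModuleCat.of R (Fin (P.r j) → R)) (fun j ↦ ModuleCat.ofHom (P.d j)) j

theorem complex_exactAt_succ (n : ℕ) : P.complex.ExactAt (n + 1) := by
  rw [HomologicalComplex.exactAt_iff' _ (n + 1 + 1) (n + 1) n (by simp) (by simp)]
  rw [ShortComplex.moduleCat_exact_iff_range_eq_ker]
  have h1 : (P.complex.sc' (n + 1 + 1) (n + 1) n).f = ModuleCat.ofHom (P.d (n + 1)) :=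
    P.complex_d (n + 1)
  have h2 : (P.complex.sc' (n + 1 + 1) (n + 1) n).g = ModuleCat.ofHom (P.d n) :=
    P.complex_d n
  have := LinearMap.exact_iff.1 (P.exact_d n)
  rw [h1, h2]
  exact this.symm

/-- The augmentation of the chain complex. -/
noncomputable def complexπ : P.complex ⟶ (ChainComplex.single₀ (ModuleCat.{u} R)).obj
    (ModuleCat.of R B) :=
  (ChainComplex.toSingle₀Equiv _ _).symm ⟨ModuleCat.ofHom P.ε, by
    rw [P.complex_d 0]
    exact congrArg ModuleCat.ofHom P.exact_ε.linearMap_comp_eq_zero⟩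

theorem complexπ_f : P.complexπ.f 0 = ModuleCat.ofHom P.ε :=
  ChainComplex.toSingle₀Equiv_symm_apply_f_zero _ _

/-- The projective resolution given by a finite free resolution. -/
noncomputable def projectiveResolution : ProjectiveResolution (ModuleCat.of R B) where
  complex := P.complex
  projective n := by
    change Projective (ModuleCat.of R (Fin (P.r n) → R))
    infer_instance
  π := P.complexπ
  quasiIso := ⟨fun n => by
    cases n
    · rw [ChainComplex.quasiIsoAt₀_iff, ShortComplex.quasiIso_iff_of_zeros']
      · refine (ShortComplex.exact_and_epi_g_iff_of_iso
          (S₁ := ShortComplex.mk (ModuleCat.ofHom (P.d 0)) (ModuleCat.ofHom P.ε)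
            (congrArg ModuleCat.ofHom P.exact_ε.linearMap_comp_eq_zero)) ?_).1 ⟨?_, ?_⟩
        · refine ShortComplex.isoMk (Iso.refl _) (Iso.refl _) (Iso.refl _) ?_ ?_
          · exact (Category.id_comp _).trans ((P.complex_d 0).trans (Category.comp_id _).symm)
          · exact (Category.id_comp _).trans (P.complexπ_f.trans (Category.comp_id _).symm)
        · rw [ShortComplex.moduleCat_exact_iff_range_eq_ker]
          exact (LinearMap.exact_iff.1 P.exact_ε).symm
        · exact (ModuleCat.epi_iff_surjective _).2 P.surjective_ε
      all_goals rfl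
    · rw [quasiIsoAt_iff_exactAt']
      · exact P.complex_exactAt_succ _
      · apply ChainComplex.exactAt_succ_single_obj⟩

end FreeRes

theorem nonempty_homology_equiv {R : Type u} [CommRing R] (S : ShortComplex (ModuleCat.{u} R))
    {Y₁ Y₂ Y₃ : Type u} [AddCommGroup Y₁] [Module R Y₁] [AddCommGroup Y₂] [Module R Y₂]
    [AddCommGroup Y₃] [Module R Y₃] (g₁ : Y₁ →ₗ[R] Y₂) (g₂ : Y₂ →ₗ[R] Y₃)
    (e₁ : S.X₁ ≃ₗ[R] Y₁) (e₂ : S.X₂ ≃ₗ[R] Y₂) (e₃ : S.X₃ ≃ₗ[R] Y₃)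
    (h₁ : ∀ x, e₂ (S.f.hom x) = g₁ (e₁ x)) (h₂ : ∀ x, e₃ (S.g.hom x) = g₂ (e₂ x)) :
    Nonempty (S.homology ≃ₗ[R]
      (LinearMap.ker g₂ ⧸ (LinearMap.range g₁).comap (LinearMap.ker g₂).subtype)) := by
  have hker : (LinearMap.ker S.g.hom).map (e₂ : S.X₂ →ₗ[R] Y₂) = LinearMap.ker g₂ := by
    ext y
    rw [Submodule.mem_map_equiv, LinearMap.mem_ker, LinearMap.mem_ker,
      ← e₂.apply_symm_apply y, ← h₂, e₂.apply_symm_apply]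
    simp
  let e := (e₂.submoduleMap (LinearMap.ker S.g.hom)).trans (LinearEquiv.ofEq _ _ hker)
  have he : ∀ x, ((e x : LinearMap.ker g₂) : Y₂) = e₂ x := fun x ↦ rfl
  refine ⟨S.moduleCatHomologyIso.toLinearEquiv.trans
    (Submodule.Quotient.equiv (LinearMap.range S.moduleCatToCycles) _ e ?_)⟩
  ext y
  rw [Submodule.mem_map, Submodule.mem_comap]
  constructor
  · rintro ⟨_, ⟨x, rfl⟩, rfl⟩
    exact ⟨e₁ x, (h₁ x).symm⟩
  · rintro ⟨x, hx⟩
    refine ⟨S.moduleCatToCycles (e₁.symm x), ⟨_, rfl⟩, Subtype.ext ?_⟩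
    refine (h₁ _).trans ?_
    rw [e₁.apply_symm_apply]
    exact hx

namespace FreeRes

variable {R : Type u} [CommRing R] {B : Type u} [AddCommGroup B] [Module R B]

theorem nonempty_extModule_succ_equiv (P : FreeRes R B) (X : Type u) [AddCommGroup X] [Module R X]
    (j : ℕ) :
    Nonempty (extModule R (j + 1) B X ≃ₗ[R] HomCohomology (P.d (j + 1)) (P.d j) X) := by
  let K := P.complex.linearYonedaObj R (ModuleCat.of R X)
  have e₀ : ((Ext R (ModuleCat.{u} R) (j + 1)).obj (Opposite.op (ModuleCat.of R B))).obj
      (ModuleCat.of R X) ≅ K.homology (j + 1) :=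
    P.projectiveResolution.isoExt (j + 1) (ModuleCat.of R X)
  have e₁ : K.homology (j + 1) ≅ (K.sc' j (j + 1) (j + 2)).homology :=
    ShortComplex.homologyMapIso (K.isoSc' j (j + 1) (j + 2) (by simp) (by simp))
  have hd : ∀ k (x : P.complex.X k ⟶ ModuleCat.of R X),
    (K.d k (k + 1)).hom x = P.complex.d (k + 1) k ≫ x := fun k x ↦ rfl
  obtain ⟨e₂⟩ := nonempty_homology_equiv (K.sc' j (j + 1) (j + 2))
    (LinearMap.lcomp R X (P.d j)) (LinearMap.lcomp R X (P.d (j + 1)))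
    (ModuleCat.homLinearEquiv (S := R) (M := ModuleCat.of R (Fin (P.r j) → R))
      (N := ModuleCat.of R X))
    (ModuleCat.homLinearEquiv (S := R) (M := ModuleCat.of R (Fin (P.r (j + 1)) → R))
      (N := ModuleCat.of R X))
    (ModuleCat.homLinearEquiv (S := R) (M := ModuleCat.of R (Fin (P.r (j + 2)) → R))
      (N := ModuleCat.of R X))
    (fun x ↦ (congrArg ModuleCat.Hom.hom ((hd j x).trans (by rw [P.complex_d]; rfl)) :))
    (fun x ↦ (congrArg ModuleCat.Hom.hom ((hd (j + 1) x).trans (by rw [P.complex_d]; rfl)) :))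
  exact ⟨(e₀ ≪≫ e₁).toLinearEquiv.trans e₂⟩

theorem nonempty_extModule_zero_equiv (P : FreeRes R B) (X : Type u) [AddCommGroup X] [Module R X] :
    Nonempty (extModule R 0 B X ≃ₗ[R] (B →ₗ[R] X)) := by
  let K := P.complex.linearYonedaObj R (ModuleCat.of R X)
  have e₀ : ((Ext R (ModuleCat.{u} R) 0).obj (Opposite.op (ModuleCat.of R B))).obj
      (ModuleCat.of R X) ≅ K.homology 0 :=
    P.projectiveResolution.isoExt 0 (ModuleCat.of R X)
  have e₁ : K.homology 0 ≅ (K.sc' 0 0 1).homology :=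
    ShortComplex.homologyMapIso (K.isoSc' 0 0 1 (by simp) (by simp))
  have hd : ∀ k (x : P.complex.X k ⟶ ModuleCat.of R X),
    (K.d k (k + 1)).hom x = P.complex.d (k + 1) k ≫ x := fun k x ↦ rfl
  have h0 : K.d 0 0 = 0 := K.shape 0 0 (by simp)
  have h0' : (K.sc' 0 0 1).f = 0 := h0
  let e := (ModuleCat.homLinearEquiv (S := R) (M := ModuleCat.of R (Fin (P.r 0) → R))
      (N := ModuleCat.of R X))
  obtain ⟨e₂⟩ := nonempty_homology_equiv (K.sc' 0 0 1)
    (0 : ((Fin (P.r 0) → R) →ₗ[R] X) →ₗ[R] _) (LinearMap.lcomp R X (P.d 0)) e e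
    (ModuleCat.homLinearEquiv (S := R) (M := ModuleCat.of R (Fin (P.r 1) → R))
      (N := ModuleCat.of R X))
    (fun x ↦ by rw [h0']; exact map_zero e)
    (fun x ↦ (congrArg ModuleCat.Hom.hom ((hd 0 x).trans (by rw [P.complex_d]; rfl)) :))
  let q : (B →ₗ[R] X) →ₗ[R] LinearMap.ker (LinearMap.lcomp R X (P.d 0)) :=
    (LinearMap.lcomp R X P.ε).codRestrict _ fun x ↦ LinearMap.ext fun y ↦ by
      change x (P.ε (P.d 0 y)) = 0
      rw [P.exact_ε.apply_apply_eq_zero, map_zero]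
  let q' := Submodule.mkQ ((LinearMap.range
    (0 : ((Fin (P.r 0) → R) →ₗ[R] X) →ₗ[R] ((Fin (P.r 0) → R) →ₗ[R] X))).comap
    (LinearMap.ker (LinearMap.lcomp R X (P.d 0))).subtype) ∘ₗ q
  have hq' : Function.Bijective q' := by
    constructor
    · refine LinearMap.ker_eq_bot.1 (LinearMap.ker_eq_bot'.2 fun x hx ↦ ?_)
      obtain ⟨y, hy⟩ := (Submodule.Quotient.mk_eq_zero _).1 hx
      have hx' : x ∘ₗ P.ε = 0 := hy.symm
      refine LinearMap.ext fun b ↦ ?_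
      obtain ⟨b, rfl⟩ := P.surjective_ε b
      exact LinearMap.congr_fun hx' b
    · intro y
      obtain ⟨⟨y, hy⟩, rfl⟩ := Submodule.Quotient.mk_surjective _ y
      have hle : LinearMap.ker P.ε ≤ LinearMap.ker y := by
        intro z hz
        obtain ⟨w, rfl⟩ := (P.exact_ε z).1 hz
        exact LinearMap.congr_fun (LinearMap.mem_ker.1 hy) w
      let x := (LinearMap.ker P.ε).liftQ y hle ∘ₗ
        (P.ε.quotKerEquivOfSurjective P.surjective_ε).symm.toLinearMap
      refine ⟨x, congrArg (Submodule.Quotient.mk) (Subtype.ext (LinearMap.ext fun z ↦ ?_))⟩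
      change (LinearMap.ker P.ε).liftQ y hle ((P.ε.quotKerEquivOfSurjective P.surjective_ε).symm
        (P.ε z)) = y z
      rw [LinearMap.quotKerEquivOfSurjective_symm_apply, Submodule.liftQ_apply]
  exact ⟨((e₀ ≪≫ e₁).toLinearEquiv.trans e₂).trans (LinearEquiv.ofBijective q' hq').symm⟩

end FreeRes

/-! ### Modules with small cohomology -/

theorem exists_injective_embedding (R : Type u) [CommRing R] (X : Type u) [AddCommGroup X]
    [Module R X] : ∃ (J : ModuleCat.{u} R) (ι : X →ₗ[R] J),
      Module.Injective R J ∧ Function.Injective ι := by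
  let J := Injective.under (ModuleCat.of R X)
  have hJ : Injective (ModuleCat.of R J) := inferInstanceAs (Injective J)
  exact ⟨J, (Injective.ι (ModuleCat.of R X)).hom,
    Module.injective_module_of_injective_object R J,
    (ModuleCat.mono_iff_injective _).1 inferInstance⟩

theorem LinearMap.exact_mkQ_range {R X Y : Type*} [CommRing R] [AddCommGroup X] [Module R X]
    [AddCommGroup Y] [Module R Y] (f : X →ₗ[R] Y) :
    Function.Exact f (LinearMap.range f).mkQ := by
  rw [LinearMap.exact_iff, Submodule.ker_mkQ]

/-- The cohomology of `Hom(P, X)` is killed by the annihilator of the resolved module. -/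
theorem FreeRes.smul_homCohomology_eq_zero {R : Type u} [CommRing R] {B : Type u}
    [AddCommGroup B] [Module R B] (P : FreeRes R B) (a : R) (ha : ∀ b : B, a • b = 0) (j : ℕ)
    (X : Type u) [AddCommGroup X] [Module R X]
    (x : HomCohomology (P.d (j + 1)) (P.d j) X) : a • x = 0 := by
  induction j generalizing X with
  | zero =>
    obtain ⟨J, ι, hJ, hι⟩ := exists_injective_embedding R X
    obtain ⟨δ, hδ, -⟩ := exists_connecting_hom_of_surjective (P.d 1) (P.d 0) P.ε (P.exact_d 0)
      P.exact_ε P.surjective_ε ι (LinearMap.range ι).mkQ hι (Submodule.mkQ_surjective _)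
      ι.exact_mkQ_range
    obtain ⟨z, rfl⟩ := hδ x
    rw [← map_smul, show a • z = 0 from LinearMap.ext fun b ↦ by
      rw [LinearMap.smul_apply, ← map_smul, ha, map_zero, LinearMap.zero_apply], map_zero]
  | succ j ih =>
    obtain ⟨J, ι, hJ, hι⟩ := exists_injective_embedding R X
    obtain ⟨e⟩ := nonempty_homCohomology_equiv (P.d (j + 2)) (P.d (j + 1)) (P.d j)
      (P.exact_d _) (P.exact_d _) ι (LinearMap.range ι).mkQ hι (Submodule.mkQ_surjective _)
      ι.exact_mkQ_range
    obtain ⟨z, rfl⟩ := e.surjective x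
    rw [← map_smul, ih, map_zero]

namespace IsPowerTorsion

variable {R : Type*} [CommRing R] {J : Ideal R} {X Y Z : Type*} [AddCommGroup X] [Module R X]
  [AddCommGroup Y] [Module R Y] [AddCommGroup Z] [Module R Z]

theorem of_injective (g : X →ₗ[R] Y) (hg : Function.Injective g) (h : IsPowerTorsion Y J) :
    IsPowerTorsion X J := by
  intro x
  obtain ⟨t, ht⟩ := h (g x)
  exact ⟨t, fun a ha ↦ hg (by rw [map_smul, ht a ha, map_zero])⟩

theorem of_exact [IsNoetherianRing R] (g : X →ₗ[R] Y) (h : Y →ₗ[R] Z)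
    (hgh : Function.Exact g h) (hX : IsPowerTorsion X J) (hZ : IsPowerTorsion Z J) :
    IsPowerTorsion Y J := by
  intro y
  obtain ⟨t, ht⟩ := hZ (h y)
  obtain ⟨F, hF⟩ := IsNoetherian.noetherian (J ^ t)
  have key : ∀ a : R, ∃ s : ℕ, a ∈ J ^ t → ∀ b ∈ J ^ s, b • a • y = 0 := by
    intro a
    by_cases ha : a ∈ J ^ t
    · obtain ⟨x, hx⟩ := (hgh (a • y)).1 (by rw [map_smul, ht a ha])
      obtain ⟨s, hs⟩ := hX x
      exact ⟨s, fun _ b hb ↦ by rw [← hx, ← map_smul, hs b hb, map_zero]⟩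
    · exact ⟨0, fun h ↦ absurd h ha⟩
  choose s hs using key
  refine ⟨t + F.sup s, ?_⟩
  have hb : ∀ b ∈ J ^ F.sup s, ∀ a ∈ J ^ t, b • a • y = 0 := by
    intro b hb a ha
    rw [← hF] at ha
    have hle : Submodule.span R (F : Set R) ≤
        LinearMap.ker (b • LinearMap.toSpanSingleton R Y y) := by
      rw [Submodule.span_le]
      intro c hc
      exact hs c (hF ▸ Submodule.subset_span hc) b
        (Ideal.pow_le_pow_right (Finset.le_sup (Finset.mem_coe.1 hc)) hb)
    exact hle ha
  intro a ha
  rw [pow_add] at ha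
  refine Submodule.mul_induction_on ha (fun c hc d hd ↦ ?_) fun c d hc hd ↦ ?_
  · rw [mul_comm, mul_smul, hb d hd c hc]
  · rw [add_smul, hc, hd, add_zero]

theorem pi [IsNoetherianRing R] (hX : IsPowerTorsion X J) (n : ℕ) :
    IsPowerTorsion (Fin n → X) J := by
  intro x
  choose t ht using hX
  refine ⟨Finset.univ.sup fun i ↦ t (x i), fun a ha ↦ funext fun i ↦ ?_⟩
  exact ht (x i) a (Ideal.pow_le_pow_right
    (Finset.le_sup (f := fun i ↦ t (x i)) (Finset.mem_univ i)) ha)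

end IsPowerTorsion

/-- A module that is Matlis reflexive and torsion with respect to the maximal ideal. -/
def IsSmall (R E X : Type u) [CommRing R] [IsLocalRing R] [AddCommGroup E] [Module R E]
    [AddCommGroup X] [Module R X] : Prop :=
  MatlisReflexive R E X ∧ IsPowerTorsion X (IsLocalRing.maximalIdeal R)

namespace IsSmall

variable {R : Type u} [CommRing R] [IsLocalRing R] {E : Type u} [AddCommGroup E] [Module R E]
  [hE : IsResidueHull R E]
  {X Y Z : Type u} [AddCommGroup X] [Module R X] [AddCommGroup Y] [Module R Y]
  [AddCommGroup Z] [Module R Z]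

theorem of_injective (g : X →ₗ[R] Y) (hg : Function.Injective g) (h : IsSmall R E Y) :
    IsSmall R E X :=
  ⟨h.1.of_injective g hg, h.2.of_injective g hg⟩

theorem of_exact [IsNoetherianRing R] (g : X →ₗ[R] Y) (h : Y →ₗ[R] Z)
    (hh : Function.Surjective h) (hgh : Function.Exact g h) (hX : IsSmall R E X)
    (hZ : IsSmall R E Z) : IsSmall R E Y :=
  ⟨hX.1.of_exact g h hh hgh hZ.1, hX.2.of_exact g h hgh hZ.2⟩

theorem pi [IsNoetherianRing R] (hX : IsSmall R E X) (n : ℕ) : IsSmall R E (Fin n → X) :=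
  ⟨hX.1.pi n, hX.2.pi n⟩

end IsSmall

/-- Some power of the ideal `J` kills the module `B`. -/
def IsKilledByPower {R : Type*} [CommRing R] (J : Ideal R) (B : Type*) [AddCommGroup B]
    [Module R B] : Prop :=
  ∃ t : ℕ, ∀ a ∈ J ^ t, ∀ b : B, a • b = 0

/-- All `Ext^j(B, X)` are small, for all finite modules `B` killed by a power of `J`. -/
structure HasSmallExt (R E : Type u) [CommRing R] [IsLocalRing R] [AddCommGroup E] [Module R E]
    (J : Ideal R) (X : Type u) [AddCommGroup X] [Module R X] : Prop where
  hom (B : Type u) [AddCommGroup B] [Module R B] [Module.Finite R B] (hB : IsKilledByPower J B) :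
    IsSmall R E (B →ₗ[R] X)
  cohomology (B : Type u) [AddCommGroup B] [Module R B] [Module.Finite R B]
    (hB : IsKilledByPower J B) (P : FreeRes R B) (j : ℕ) :
    IsSmall R E (HomCohomology (P.d (j + 1)) (P.d j) X)

section HasSmallExt

variable {R : Type u} [CommRing R] [IsLocalRing R] [IsNoetherianRing R]
  {E : Type u} [AddCommGroup E] [Module R E] [hE : IsResidueHull R E]

theorem MatlisReflexive.hom_of_finite {X : Type u} [AddCommGroup X] [Module R X]
    (hX : MatlisReflexive R E X) (B : Type u) [AddCommGroup B] [Module R B] [Module.Finite R B] :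
    MatlisReflexive R E (B →ₗ[R] X) := by
  obtain ⟨n, g, hg⟩ := Module.Finite.exists_fin' R B
  let e : (B →ₗ[R] X) →ₗ[R] (Fin n → X) :=
    LinearMap.pi fun i ↦ LinearMap.applyₗ (g (Pi.single i 1))
  refine (hX.pi n).of_injective e ?_
  intro φ ψ h
  refine LinearMap.ext fun b ↦ ?_
  obtain ⟨y, rfl⟩ := hg b
  have : φ ∘ₗ g = ψ ∘ₗ g := LinearMap.pi_ext' fun i ↦ LinearMap.ext_ring (congrFun h i)
  exact LinearMap.congr_fun this y

theorem MatlisReflexive.hasSmallExt {J : Ideal R} {M : Type u} [AddCommGroup M] [Module R M]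
    (hM : MatlisReflexive R E M)
    (hJ : ∀ S : Submodule R M, S.FG → ∀ t, ∃ s, IsLocalRing.maximalIdeal R ^ s ≤
      J ^ t ⊔ Module.annihilator R S) : HasSmallExt R E J M where
  hom B _ _ _ hB := by
    refine ⟨hM.hom_of_finite B, fun φ ↦ ?_⟩
    obtain ⟨t, ht⟩ := hB
    obtain ⟨s, hs⟩ := hJ (LinearMap.range φ) (φ.range_eq_map ▸ Module.Finite.fg_top.map φ) t
    refine ⟨s, fun c hc ↦ ?_⟩
    obtain ⟨a, ha, e, he, rfl⟩ := Submodule.mem_sup.1 (hs hc)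
    refine LinearMap.ext fun b ↦ ?_
    have h1 : a • φ b = 0 := by rw [← map_smul, ht a ha, map_zero]
    have h2 : e • φ b = 0 :=
      congrArg Subtype.val (Module.mem_annihilator.1 he ⟨φ b, LinearMap.mem_range_self _ _⟩)
    rw [LinearMap.smul_apply, add_smul, h1, h2, add_zero, LinearMap.zero_apply]
  cohomology B _ _ _ hB P j := by
    refine ⟨((hM.hom_of_finite (Fin (P.r (j + 1)) → R)).of_injective _
      (Submodule.injective_subtype _)).of_surjective _ (Submodule.mkQ_surjective _), fun x ↦ ?_⟩
    obtain ⟨⟨φ, hφ⟩, rfl⟩ := Submodule.Quotient.mk_surjective _ x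
    obtain ⟨t, ht⟩ := hB
    obtain ⟨s, hs⟩ := hJ (LinearMap.range φ) (φ.range_eq_map ▸ Module.Finite.fg_top.map φ) t
    refine ⟨s, fun c hc ↦ ?_⟩
    obtain ⟨a, ha, e, he, rfl⟩ := Submodule.mem_sup.1 (hs hc)
    rw [add_smul, P.smul_homCohomology_eq_zero a (ht a ha), zero_add, ← Submodule.Quotient.mk_smul]
    have h2 : e • φ = 0 := LinearMap.ext fun y ↦
      congrArg Subtype.val (Module.mem_annihilator.1 he ⟨φ y, LinearMap.mem_range_self _ _⟩)
    have h3 : e • (⟨φ, hφ⟩ : LinearMap.ker (LinearMap.lcomp R M (P.d (j + 1)))) = 0 :=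
      Subtype.ext h2
    rw [h3, Submodule.Quotient.mk_zero]

theorem HasSmallExt.of_exact {J : Ideal R} {X X₀ X' : Type u} [AddCommGroup X] [Module R X]
    [AddCommGroup X₀] [Module R X₀] [AddCommGroup X'] [Module R X'] [Module.Injective R X₀]
    (hX : HasSmallExt R E J X)
    (hX₀ : ∀ (B : Type u) [AddCommGroup B] [Module R B] [Module.Finite R B],
      IsKilledByPower J B → IsSmall R E (B →ₗ[R] X₀))
    (ι : X →ₗ[R] X₀) (π : X₀ →ₗ[R] X') (hι : Function.Injective ι) (hπ : Function.Surjective π)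
    (hιπ : Function.Exact ι π) : HasSmallExt R E J X' where
  hom B _ _ _ hB := by
    obtain ⟨P⟩ := FreeRes.nonempty R B
    obtain ⟨δ, hδ, hδ0⟩ := exists_connecting_hom_of_surjective (P.d 1) (P.d 0) P.ε (P.exact_d 0)
      P.exact_ε P.surjective_ε ι π hι hπ hιπ
    exact IsSmall.of_exact (LinearMap.llcomp R B X₀ X' π) δ hδ hδ0 (hX₀ B hB)
      (hX.cohomology B hB P 0)
  cohomology B _ _ _ hB P j := by
    obtain ⟨e⟩ := nonempty_homCohomology_equiv (P.d (j + 2)) (P.d (j + 1)) (P.d j)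
      (P.exact_d _) (P.exact_d _) ι π hι hπ hιπ
    exact (hX.cohomology B hB P (j + 1)).of_injective e.toLinearMap e.injective

end HasSmallExt

/-! ### Embeddings into injective modules -/

section Embedding

open TensorProduct

theorem Module.Injective.linearMap_of_flat (R L G : Type u) [CommRing R] [AddCommGroup L]
    [Module R L] [AddCommGroup G] [Module R G] [Module.Flat R L] [hG : Module.Injective R G] :
    Module.Injective R (L →ₗ[R] G) where
  out A B _ _ _ _ f hf g := by
    obtain ⟨h, hh⟩ := hG.out (f.rTensor L) (Module.Flat.rTensor_preserves_injective_linearMap f hf)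
      (TensorProduct.lift g)
    exact ⟨TensorProduct.curry h, fun a ↦ LinearMap.ext fun l ↦ by simpa using hh (a ⊗ₜ l)⟩

theorem Module.Injective.prod (R G₁ G₂ : Type u) [CommRing R] [AddCommGroup G₁] [Module R G₁]
    [AddCommGroup G₂] [Module R G₂] [h₁ : Module.Injective R G₁] [h₂ : Module.Injective R G₂] :
    Module.Injective R (G₁ × G₂) where
  out A B _ _ _ _ f hf g := by
    obtain ⟨k₁, hk₁⟩ := h₁.out f hf (LinearMap.fst R G₁ G₂ ∘ₗ g)
    obtain ⟨k₂, hk₂⟩ := h₂.out f hf (LinearMap.snd R G₁ G₂ ∘ₗ g)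
    exact ⟨k₁.prod k₂, fun a ↦ Prod.ext (hk₁ a) (hk₂ a)⟩

/-- No nonzero element of the module is killed by the ideal `J`. -/
def IsTorsionFreeAt {R : Type*} [CommRing R] (J : Ideal R) (G : Type*) [AddCommGroup G]
    [Module R G] : Prop :=
  ∀ x : G, (∀ a ∈ J, a • x = 0) → x = 0

namespace IsTorsionFreeAt

variable {R : Type*} [CommRing R] {J : Ideal R} {G : Type*} [AddCommGroup G] [Module R G]

theorem eq_zero_of_pow (hG : IsTorsionFreeAt J G) (t : ℕ) (x : G)
    (hx : ∀ a ∈ J ^ t, a • x = 0) : x = 0 := by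
  induction t generalizing x with
  | zero => simpa using hx 1 (by simp)
  | succ t ih =>
    refine hG x fun a ha ↦ ih (a • x) fun b hb ↦ ?_
    rw [← mul_smul]
    exact hx _ (by rw [pow_succ]; exact Ideal.mul_mem_mul hb ha)

theorem hom_eq_zero (hG : IsTorsionFreeAt J G) {B : Type*} [AddCommGroup B] [Module R B]
    (hB : IsKilledByPower J B) (φ : B →ₗ[R] G) : φ = 0 := by
  obtain ⟨t, ht⟩ := hB
  exact LinearMap.ext fun b ↦ hG.eq_zero_of_pow t _ fun a ha ↦ by rw [← map_smul, ht a ha, map_zero]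

theorem eq_zero_of_isPowerTorsion (hG : IsTorsionFreeAt J G) {B : Type*} [AddCommGroup B]
    [Module R B] (hB : IsPowerTorsion B J) (φ : B →ₗ[R] G) : φ = 0 := by
  refine LinearMap.ext fun b ↦ ?_
  obtain ⟨t, ht⟩ := hB b
  exact hG.eq_zero_of_pow t _ fun a ha ↦ by rw [← map_smul, ht a ha, map_zero]

theorem mono {J' : Ideal R} (hG : IsTorsionFreeAt J G) (h : J ≤ J') : IsTorsionFreeAt J' G :=
  fun x hx ↦ hG x fun a ha ↦ hx a (h ha)

end IsTorsionFreeAt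

theorem IsTorsionFreeAt.exists_injective_embedding {R : Type u} [CommRing R] [IsNoetherianRing R]
    {J : Ideal R} {K : Type u} [AddCommGroup K] [Module R K] (hK : IsTorsionFreeAt J K) :
    ∃ (G : ModuleCat.{u} R) (ι : K →ₗ[R] G),
      Module.Injective R G ∧ IsTorsionFreeAt J G ∧ Function.Injective ι := by
  obtain ⟨F, hF⟩ := IsNoetherian.noetherian J
  have hemb (a : F) := _root_.exists_injective_embedding R
    (LocalizedModule (Submonoid.powers (a : R)) K)
  choose G₀ ι₀ hG₀ hι₀ using hemb
  let H (a : F) : Type u := Localization (Submonoid.powers (a : R)) →ₗ[R] G₀ a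
  have hH (a : F) : Module.Injective R (H a) := by
    have := IsLocalization.flat (Localization (Submonoid.powers (a : R)))
      (Submonoid.powers (a : R))
    exact Module.Injective.linearMap_of_flat R _ (G₀ a)
  let κ (a : F) : K →ₗ[R] H a := LinearMap.mk₂ R
    (fun x r ↦ ι₀ a (r • LocalizedModule.mkLinearMap (Submonoid.powers (a : R)) K x))
    (fun x y r ↦ by rw [map_add, smul_add, map_add])
    (fun c x r ↦ by
      rw [(LocalizedModule.mkLinearMap (Submonoid.powers (a : R)) K).map_smul, smul_comm,
        (ι₀ a).map_smul])
    (fun x r r' ↦ by rw [add_smul, map_add])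
    (fun c x r ↦ by rw [smul_assoc, map_smul])
  have hκ (a : F) (x : K) :
      κ a x 1 = ι₀ a (LocalizedModule.mkLinearMap (Submonoid.powers (a : R)) K x) := by
    change ι₀ a ((1 : Localization (Submonoid.powers (a : R))) • _) = _
    rw [one_smul]
  refine ⟨ModuleCat.of R ((a : F) → H a), LinearMap.pi κ, Module.Injective.pi .., ?_, ?_⟩
  · intro f hf
    funext a
    have h1 : (a : R) • f a = 0 := congrFun (hf a (hF ▸ Submodule.subset_span a.2)) a
    refine LinearMap.ext fun r ↦ ?_
    obtain ⟨u, hu⟩ := (IsLocalization.map_units (Localization (Submonoid.powers (a : R)))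
      ⟨(a : R), Submonoid.mem_powers _⟩)
    have hr : r = (a : R) • ((↑u⁻¹ : Localization (Submonoid.powers (a : R))) * r) := by
      rw [Algebra.smul_def, ← mul_assoc]
      change r = algebraMap R (Localization (Submonoid.powers (a : R))) (a : R) * _ * r
      rw [← show (u : Localization (Submonoid.powers (a : R))) = algebraMap R _ (a : R) from hu,
        Units.mul_inv, one_mul]
    rw [hr, map_smul]
    exact LinearMap.congr_fun h1 _
  · refine LinearMap.ker_eq_bot.1 (LinearMap.ker_eq_bot'.2 fun x hx ↦ ?_)
    have h1 (a : F) : ∃ n : ℕ, (a : R) ^ n • x = 0 := by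
      have h2 : ι₀ a (LocalizedModule.mkLinearMap (Submonoid.powers (a : R)) K x) = 0 := by
        rw [← hκ, show κ a x = 0 from congrFun hx a, LinearMap.zero_apply]
      rw [map_eq_zero_iff _ (hι₀ a)] at h2
      obtain ⟨_, ⟨n, rfl⟩, hn⟩ := LocalizedModule.mem_ker_mkLinearMap_iff.1 h2
      exact ⟨n, hn⟩
    have h3 : J ≤ Ideal.radical (LinearMap.ker (LinearMap.toSpanSingleton R K x)) := by
      rw [← hF]
      exact Submodule.span_le.2 fun a ha ↦ h1 ⟨a, ha⟩
    obtain ⟨t, ht⟩ := Ideal.exists_pow_le_of_le_radical_of_fg h3 ⟨F, hF⟩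
    exact hK.eq_zero_of_pow t x fun a ha ↦ ht ha

theorem isKilledByPower_quotient {R : Type*} [CommRing R] {J J' : Ideal R} (h : J ≤ J') :
    IsKilledByPower J (R ⧸ J') := ⟨1, fun a ha b ↦ by
  obtain ⟨b, rfl⟩ := Submodule.Quotient.mk_surjective _ b
  rw [pow_one] at ha
  rw [← Submodule.Quotient.mk_smul, Submodule.Quotient.mk_eq_zero]
  exact J'.mul_mem_right _ (h ha)⟩

variable {R : Type u} [CommRing R] [IsLocalRing R] [IsNoetherianRing R]
  {E : Type u} [AddCommGroup E] [Module R E] [hE : IsResidueHull R E]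

open IsLocalRing

theorem HasSmallExt.exists_embedding {J : Ideal R} (hJ : J ≤ maximalIdeal R)
    {X : Type u} [AddCommGroup X] [Module R X] (hX : HasSmallExt R E J X) :
    ∃ (q : ℕ) (G : ModuleCat.{u} R) (ι : X →ₗ[R] (Fin q → E) × G),
      Module.Injective R G ∧ IsTorsionFreeAt J G ∧ Function.Injective ι := by
  obtain ⟨q, g, hg⟩ := exists_pi_injOn_socle (hX.hom _ (isKilledByPower_quotient hJ)).1
  have hKm : IsTorsionFreeAt (maximalIdeal R) (LinearMap.ker g) := fun x hx ↦
    Subtype.ext (hg x (fun a ha ↦ congrArg Subtype.val (hx a ha)) x.2)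
  have hK : IsTorsionFreeAt J (LinearMap.ker g) := by
    intro x hx
    let φ : (R ⧸ J) →ₗ[R] X := J.liftQ (LinearMap.toSpanSingleton R X x) fun a ha ↦
      congrArg Subtype.val (hx a ha)
    obtain ⟨s, hs⟩ := (hX.hom _ (isKilledByPower_quotient le_rfl)).2 φ
    refine hKm.eq_zero_of_pow s x fun a ha ↦ Subtype.ext ?_
    have h1 : φ (Submodule.Quotient.mk 1) = x := one_smul R (x : X)
    have h2 : a • φ (Submodule.Quotient.mk 1) = 0 :=
      LinearMap.congr_fun (hs a ha) (Submodule.Quotient.mk 1)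
    rw [h1] at h2
    exact h2
  obtain ⟨G, κ, hG, hGJ, hκ⟩ := hK.exists_injective_embedding
  obtain ⟨κ', hκ'⟩ := hG.out (LinearMap.ker g).subtype (Submodule.injective_subtype _) κ
  refine ⟨q, G, g.prod κ', hG, hGJ, LinearMap.ker_eq_bot.1 (LinearMap.ker_eq_bot'.2 fun x hx ↦ ?_)⟩
  have h1 : g x = 0 := congrArg Prod.fst hx
  have h2 : κ' x = 0 := congrArg Prod.snd hx
  have h3 : κ ⟨x, h1⟩ = 0 := (hκ' ⟨x, h1⟩).symm.trans h2
  exact congrArg Subtype.val ((map_eq_zero_iff κ hκ).1 h3)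

end Embedding

/-! ### Duality for cohomology of complexes of finite powers -/

section Pairing

variable {R : Type u} [CommRing R]

theorem Submodule.mem_ideal_smul_top_pi {N : Type*} [AddCommGroup N] [Module R N] (K : Ideal R)
    {q : ℕ} (x : Fin q → N) :
    x ∈ (K • ⊤ : Submodule R (Fin q → N)) ↔ ∀ j, x j ∈ (K • ⊤ : Submodule R N) := by
  constructor
  · intro hx j
    have := Submodule.mem_map_of_mem (f := LinearMap.proj (R := R) (φ := fun _ : Fin q ↦ N) j) hx
    rw [Submodule.map_smul''] at this
    exact Submodule.smul_mono le_rfl le_top this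
  · intro hx
    rw [← Finset.univ_sum_single x]
    refine Submodule.sum_mem _ fun j _ ↦ ?_
    have := Submodule.mem_map_of_mem (f := LinearMap.single R (fun _ : Fin q ↦ N) j) (hx j)
    rw [Submodule.map_smul''] at this
    exact Submodule.smul_mono le_rfl le_top this

/-- The action of a matrix on tuples of elements of a module. -/
noncomputable def matAct (N : Type*) [AddCommGroup N] [Module R N] {p q : ℕ}
    (C : Matrix (Fin q) (Fin p) R) : (Fin p → N) →ₗ[R] (Fin q → N) :=
  LinearMap.pi fun i ↦ ∑ j, C i j • LinearMap.proj j

section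

variable {N : Type*} [AddCommGroup N] [Module R N] {p q r : ℕ}

theorem matAct_apply (C : Matrix (Fin q) (Fin p) R) (x : Fin p → N) (i : Fin q) :
    matAct N C x i = ∑ j, C i j • x j := by
  simp [matAct]

theorem matAct_comp (C : Matrix (Fin r) (Fin q) R) (C' : Matrix (Fin q) (Fin p) R) :
    matAct N C ∘ₗ matAct N C' = matAct N (C * C') := by
  refine LinearMap.ext fun x ↦ funext fun i ↦ ?_
  rw [LinearMap.comp_apply, matAct_apply, matAct_apply]
  simp only [matAct_apply, Matrix.mul_apply, Finset.smul_sum, Finset.sum_smul, mul_smul]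
  exact Finset.sum_comm

theorem matAct_single (C : Matrix (Fin q) (Fin p) R) (j : Fin p) (x : N) (i : Fin q) :
    matAct N C (Pi.single j x) i = C i j • x := by
  rw [matAct_apply, Finset.sum_eq_single j]
  · simp
  · intro k _ hk
    simp [hk]
  · simp

end

/-- The identification of `Hom(N, E^q)` with the dual of `N^q`. -/
noncomputable def piDual (N E : Type*) [AddCommGroup N] [Module R N] [AddCommGroup E] [Module R E]
    (q : ℕ) : (N →ₗ[R] (Fin q → E)) ≃ₗ[R] ((Fin q → N) →ₗ[R] E) where
  toFun ψ := ∑ j, LinearMap.proj j ∘ₗ ψ ∘ₗ LinearMap.proj j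
  map_add' ψ ψ' := by
    simp only [LinearMap.add_comp, LinearMap.comp_add, Finset.sum_add_distrib]
  map_smul' a ψ := by
    simp only [LinearMap.smul_comp, LinearMap.comp_smul, Finset.smul_sum, RingHom.id_apply]
  invFun b := LinearMap.pi fun j ↦ b ∘ₗ LinearMap.single R (fun _ ↦ N) j
  left_inv ψ := by
    refine LinearMap.ext fun x ↦ funext fun j ↦ ?_
    simp only [LinearMap.pi_apply, LinearMap.comp_apply, LinearMap.sum_apply, LinearMap.proj_apply,
      LinearMap.single_apply]
    rw [Finset.sum_eq_single j]
    · simp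
    · intro k _ hk
      simp [hk]
    · simp
  right_inv b := by
    refine LinearMap.ext fun x ↦ ?_
    simp only [LinearMap.comp_apply, LinearMap.sum_apply, LinearMap.proj_apply,
      LinearMap.pi_apply, LinearMap.single_apply]
    rw [← map_sum, Finset.univ_sum_single]

section

variable {N E : Type*} [AddCommGroup N] [Module R N] [AddCommGroup E] [Module R E] {p q r : ℕ}

theorem piDual_apply (ψ : N →ₗ[R] (Fin q → E)) (x : Fin q → N) :
    piDual N E q ψ x = ∑ j, ψ (x j) j := by
  simp [piDual]

theorem piDual_matAct (C : Matrix (Fin q) (Fin p) R) (ψ : N →ₗ[R] (Fin p → E)) (x : Fin q → N) :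
    piDual N E q (matAct E C ∘ₗ ψ) x = piDual N E p ψ (matAct N C.transpose x) := by
  simp only [piDual_apply, LinearMap.comp_apply, matAct_apply, map_sum, map_smul,
    Finset.sum_apply, Pi.smul_apply, Matrix.transpose_apply]
  exact Finset.sum_comm

theorem exists_matAct_eq {h : (Fin p → E) →ₗ[R] (Fin q → E)}
    (hE : ∀ h : E →ₗ[R] E, ∃ r : R, ∀ e, h e = r • e) :
    ∃ C : Matrix (Fin q) (Fin p) R, h = matAct E C := by
  choose c hc using hE
  let C : Matrix (Fin q) (Fin p) R :=
    Matrix.of fun i j ↦ c (LinearMap.proj i ∘ₗ h ∘ₗ LinearMap.single R (fun _ ↦ E) j)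
  refine ⟨C, LinearMap.pi_ext fun j e ↦ funext fun i ↦ ?_⟩
  rw [matAct_single]
  exact hc (LinearMap.proj i ∘ₗ h ∘ₗ LinearMap.single R (fun _ ↦ E) j) e

end

section

variable {N E : Type u} [AddCommGroup N] [Module R N] [AddCommGroup E] [Module R E]
  [hE : Module.Injective R E] {p q r : ℕ}

/-- The cohomology of `Hom(N / D, E^p) → Hom(N / D, E^q) → Hom(N / D, E^r)` is the dual of the
relative cohomology of `N^r → N^q → N^p`. -/
theorem exists_dual_cohomology_map (C' : Matrix (Fin r) (Fin q) R) (C : Matrix (Fin q) (Fin p) R)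
    (D : Submodule R N) (Dq : Submodule R (Fin q → N)) (Dp : Submodule R (Fin p → N))
    (hDq : ∀ x, x ∈ Dq ↔ ∀ j, x j ∈ D) (hDp : ∀ x, x ∈ Dp ↔ ∀ j, x j ∈ D) :
    ∃ Θ : LinearMap.ker (LinearMap.llcomp R (N ⧸ D) (Fin q → E) (Fin r → E) (matAct E C')) →ₗ[R]
        ((↥(Dp.comap (matAct N C.transpose)) ⧸
          (LinearMap.range (matAct N C'.transpose) ⊔ Dq).comap
            (Dp.comap (matAct N C.transpose)).subtype) →ₗ[R] E),
      Function.Surjective Θ ∧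
        ∀ ψ, Θ ψ = 0 ↔ ∃ ν : (N ⧸ D) →ₗ[R] (Fin p → E), matAct E C ∘ₗ ν = ψ.1 := by
  set Z := Dp.comap (matAct N C.transpose)
  set T := LinearMap.range (matAct N C'.transpose) ⊔ Dq
  let K : Submodule R ((N ⧸ D) →ₗ[R] (Fin q → E)) :=
    LinearMap.ker (LinearMap.llcomp R (N ⧸ D) (Fin q → E) (Fin r → E) (matAct E C'))
  let l : ((N ⧸ D) →ₗ[R] (Fin q → E)) →ₗ[R] (N →ₗ[R] (Fin q → E)) :=
    LinearMap.lcomp R (Fin q → E) D.mkQ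
  let Φ : K →ₗ[R] ((Fin q → N) →ₗ[R] E) := (piDual N E q).toLinearMap ∘ₗ l ∘ₗ K.subtype
  have hΦ : ∀ ψ : K, Φ ψ = piDual N E q ((ψ : (N ⧸ D) →ₗ[R] (Fin q → E)) ∘ₗ D.mkQ) := fun ψ ↦ rfl
  have hΦT : ∀ ψ : K, T ≤ LinearMap.ker (Φ ψ) := by
    intro ψ
    refine sup_le ?_ ?_
    · rintro _ ⟨x, rfl⟩
      rw [LinearMap.mem_ker, hΦ, ← piDual_matAct, ← LinearMap.comp_assoc]
      have : matAct E C' ∘ₗ ψ.1 = 0 := ψ.2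
      rw [this, LinearMap.zero_comp, map_zero, LinearMap.zero_apply]
    · intro x hx
      rw [LinearMap.mem_ker, hΦ, piDual_apply]
      refine Finset.sum_eq_zero fun j _ ↦ ?_
      rw [LinearMap.comp_apply, Submodule.mkQ_apply,
        (Submodule.Quotient.mk_eq_zero D).2 ((hDq x).1 hx j), map_zero, Pi.zero_apply]
  let Θ : K →ₗ[R] ((Z ⧸ T.comap Z.subtype) →ₗ[R] E) :=
    { toFun := fun ψ ↦ (T.comap Z.subtype).liftQ (Φ ψ ∘ₗ Z.subtype) fun x hx ↦ hΦT ψ hx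
      map_add' := fun ψ ψ' ↦ LinearMap.ext fun x ↦ by
        obtain ⟨x, rfl⟩ := Submodule.Quotient.mk_surjective _ x
        exact LinearMap.congr_fun (map_add Φ ψ ψ') (x : Fin q → N)
      map_smul' := fun a ψ ↦ LinearMap.ext fun x ↦ by
        obtain ⟨x, rfl⟩ := Submodule.Quotient.mk_surjective _ x
        exact LinearMap.congr_fun (map_smul Φ a ψ) (x : Fin q → N) }
  have hΘ : ∀ (ψ : K) (z : Z), Θ ψ (Submodule.Quotient.mk z) = Φ ψ z := fun ψ z ↦ rfl
  refine ⟨Θ, fun η ↦ ?_, fun ψ ↦ ?_⟩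
  · obtain ⟨b, hb⟩ := Module.Injective.exists_comp_eq_of_ker_le (T.mkQ ∘ₗ Z.subtype)
      (η ∘ₗ (T.comap Z.subtype).mkQ) (by
        intro x hx
        have : (T.comap Z.subtype).mkQ x = 0 := (Submodule.Quotient.mk_eq_zero _).2
          ((Submodule.Quotient.mk_eq_zero T).1 hx)
        rw [LinearMap.mem_ker, LinearMap.comp_apply, this, map_zero])
    let ψ₀ := (piDual N E q).symm (b ∘ₗ T.mkQ)
    have hψ₀ : piDual N E q ψ₀ = b ∘ₗ T.mkQ := LinearEquiv.apply_symm_apply _ _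
    have hD : D ≤ LinearMap.ker ψ₀ := by
      intro x hx
      refine funext fun j ↦ ?_
      change b (Submodule.Quotient.mk (Pi.single j x)) = 0
      rw [(Submodule.Quotient.mk_eq_zero T).2, map_zero]
      refine Submodule.mem_sup_right ((hDq _).2 fun i ↦ ?_)
      by_cases hij : i = j
      · subst hij
        simpa using hx
      · simp [hij]
    let ψ : (N ⧸ D) →ₗ[R] (Fin q → E) := D.liftQ ψ₀ hD
    have hψ : ψ ∘ₗ D.mkQ = ψ₀ := Submodule.liftQ_mkQ _ _ _
    have hψK : ψ ∈ K := by
      have h1 : (matAct E C' ∘ₗ ψ) ∘ₗ D.mkQ = 0 := by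
        rw [LinearMap.comp_assoc, hψ]
        refine (piDual N E r).injective (LinearMap.ext fun x ↦ ?_)
        rw [piDual_matAct, hψ₀, map_zero, LinearMap.zero_apply, LinearMap.comp_apply,
          Submodule.mkQ_apply, (Submodule.Quotient.mk_eq_zero T).2
          (Submodule.mem_sup_left (LinearMap.mem_range_self _ _)), map_zero]
      exact Submodule.linearMap_qext _ h1
    refine ⟨⟨ψ, hψK⟩, LinearMap.ext fun z ↦ ?_⟩
    obtain ⟨z, rfl⟩ := Submodule.Quotient.mk_surjective _ z
    rw [hΘ, hΦ, hψ, hψ₀]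
    exact hb z
  · constructor
    · intro h
      have h0 : ∀ z : Z, Φ ψ z = 0 := fun z ↦ by rw [← hΘ, h, LinearMap.zero_apply]
      obtain ⟨b, hb⟩ := Module.Injective.exists_comp_eq_of_ker_le
        (D.mkQ.compLeft (Fin p) ∘ₗ matAct N C.transpose) (Φ ψ) (by
          intro x hx
          refine h0 ⟨x, (hDp _).2 fun j ↦ (Submodule.Quotient.mk_eq_zero D).1 ?_⟩
          exact congrFun hx j)
      let ν := (piDual (N ⧸ D) E p).symm b
      have hν : piDual (N ⧸ D) E p ν = b := LinearEquiv.apply_symm_apply _ _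
      refine ⟨ν, Submodule.linearMap_qext _ ((piDual N E q).injective (LinearMap.ext fun x ↦ ?_))⟩
      rw [← hΦ, ← hb, ← hν, LinearMap.comp_assoc, piDual_matAct, piDual_apply,
        LinearMap.comp_apply, piDual_apply]
      rfl
    · rintro ⟨ν, hν⟩
      refine LinearMap.ext fun z ↦ ?_
      obtain ⟨z, rfl⟩ := Submodule.Quotient.mk_surjective _ z
      rw [hΘ, hΦ, ← hν, LinearMap.comp_assoc, piDual_matAct, piDual_apply, LinearMap.zero_apply]
      refine Finset.sum_eq_zero fun j _ ↦ ?_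
      rw [LinearMap.comp_apply, Submodule.mkQ_apply,
        (Submodule.Quotient.mk_eq_zero D).2 ((hDp _).1 z.2 j), map_zero, Pi.zero_apply]

end

end Pairing

/-! ### Ext modules as duals of matrix cohomology -/

/-- The module `{x ∈ N^q | C^T x ∈ K N^p} / (C'^T N^r + K N^q)`. -/
abbrev MatCohomology {R : Type u} [CommRing R] (N : Type u) [AddCommGroup N] [Module R N]
    {p q r : ℕ} (C' : Matrix (Fin r) (Fin q) R) (C : Matrix (Fin q) (Fin p) R) (K : Ideal R) :
    Type u :=
  ↥((K • ⊤ : Submodule R (Fin p → N)).comap (matAct N C.transpose)) ⧸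
    (LinearMap.range (matAct N C'.transpose) ⊔ K • ⊤).comap
      ((K • ⊤ : Submodule R (Fin p → N)).comap (matAct N C.transpose)).subtype

section

open IsLocalRing

variable {R : Type u} [CommRing R] [IsLocalRing R] [IsNoetherianRing R]
  [IsAdicComplete (maximalIdeal R) R]
  {E : Type u} [AddCommGroup E] [Module R E] [hE : IsResidueHull R E]

variable (R E) in
theorem isSmall_residueHull : IsSmall R E E :=
  ⟨MatlisReflexive.self R E, isPowerTorsion_of_isResidueHull R E⟩

theorem isSmall_hom_prod {J : Ideal R} (q : ℕ) {G : Type u} [AddCommGroup G] [Module R G]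
    (hG : IsTorsionFreeAt J G) (B : Type u) [AddCommGroup B] [Module R B] [Module.Finite R B]
    (hB : IsKilledByPower J B) : IsSmall R E (B →ₗ[R] (Fin q → E) × G) := by
  obtain ⟨n, g, hg⟩ := Module.Finite.exists_fin' R B
  let e : (B →ₗ[R] (Fin q → E) × G) →ₗ[R] (Fin n → Fin q → E) :=
    LinearMap.pi fun i ↦ LinearMap.fst R (Fin q → E) G ∘ₗ LinearMap.applyₗ (g (Pi.single i 1))
  refine (((isSmall_residueHull R E).pi q).pi n).of_injective e ?_
  rw [injective_iff_map_eq_zero]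
  intro φ h
  have h2 := hG.hom_eq_zero hB (LinearMap.snd R (Fin q → E) G ∘ₗ φ)
  refine LinearMap.ext fun b ↦ Prod.ext ?_ (LinearMap.congr_fun h2 b)
  have h1 : (LinearMap.fst R (Fin q → E) G ∘ₗ φ) ∘ₗ g = 0 :=
    LinearMap.pi_ext' fun i ↦ LinearMap.ext_ring (congrFun h i)
  obtain ⟨y, rfl⟩ := hg b
  exact LinearMap.congr_fun h1 y

theorem HasSmallExt.exists_cosyzygy {J : Ideal R} (hJ : J ≤ maximalIdeal R) {X : Type u}
    [AddCommGroup X] [Module R X] (hX : HasSmallExt R E J X) :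
    ∃ (q : ℕ) (G : ModuleCat.{u} R) (ι : X →ₗ[R] (Fin q → E) × G),
      Module.Injective R ((Fin q → E) × G) ∧ IsTorsionFreeAt J G ∧ Function.Injective ι ∧
        HasSmallExt R E J (((Fin q → E) × G) ⧸ LinearMap.range ι) := by
  obtain ⟨q, G, ι, hG, hGJ, hι⟩ := hX.exists_embedding hJ
  have : Module.Injective R (Fin q → E) := Module.Injective.pi R fun _ ↦ E
  have : Module.Injective R ((Fin q → E) × G) := Module.Injective.prod R _ _
  exact ⟨q, G, ι, this, hGJ, hι, hX.of_exact (fun B _ _ _ hB ↦ isSmall_hom_prod q hGJ B hB) ι _ hι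
    (Submodule.mkQ_surjective _) ι.exact_mkQ_range⟩

theorem exists_matAct_eq_of_prod {p q : ℕ} {G G' : Type u} [AddCommGroup G] [Module R G]
    [AddCommGroup G'] [Module R G'] (hG' : IsTorsionFreeAt (maximalIdeal R) G')
    (h : ((Fin p → E) × G) →ₗ[R] ((Fin q → E) × G')) :
    ∃ C : Matrix (Fin q) (Fin p) R, ∀ v, h (v, 0) = (matAct E C v, 0) := by
  obtain ⟨C, hC⟩ := exists_matAct_eq (E := E)
    (h := LinearMap.fst R (Fin q → E) G' ∘ₗ h ∘ₗ LinearMap.inl R (Fin p → E) G)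
    exists_forall_eq_smul
  have h2 := hG'.eq_zero_of_isPowerTorsion ((isPowerTorsion_of_isResidueHull R E).pi p)
    (LinearMap.snd R (Fin q → E) G' ∘ₗ h ∘ₗ LinearMap.inl R (Fin p → E) G)
  exact ⟨C, fun v ↦ Prod.ext (LinearMap.congr_fun hC v) (LinearMap.congr_fun h2 v)⟩

theorem eq_zero_of_matAct_eq_zero {p q : ℕ} {C : Matrix (Fin q) (Fin p) R}
    (hC : matAct E C = 0) : C = 0 := by
  ext i j
  by_contra hne
  obtain ⟨φ, hφ⟩ := exists_apply_ne_zero (R := R) E (C i j) hne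
  have h1 : φ (C i j) = C i j • φ 1 := by rw [← map_smul, smul_eq_mul, mul_one]
  rw [h1, ← matAct_single, hC] at hφ
  exact hφ rfl

/-- For a small module `X` and a map `a` from `E^p × G` to `X`, the cokernel of `Hom(B, a)` is
computed by matrices. -/
theorem HasSmallExt.exists_matrices {J : Ideal R} (hJ : J ≤ maximalIdeal R) {X : Type u}
    [AddCommGroup X] [Module R X] (hX : HasSmallExt R E J X) {p : ℕ} {G' : Type u}
    [AddCommGroup G'] [Module R G'] (hG' : IsTorsionFreeAt J G')
    (a : ((Fin p → E) × G') →ₗ[R] X) :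
    ∃ (r q : ℕ) (C' : Matrix (Fin r) (Fin q) R) (C : Matrix (Fin q) (Fin p) R), C' * C = 0 ∧
      ∀ (B : Type u) [AddCommGroup B] [Module R B], IsKilledByPower J B →
        ∃ e : (B →ₗ[R] X) →ₗ[R]
          LinearMap.ker (LinearMap.llcomp R B (Fin q → E) (Fin r → E) (matAct E C')),
          Function.Surjective e ∧ ∀ ξ, (∃ ν : B →ₗ[R] (Fin p → E) × G', a ∘ₗ ν = ξ) ↔
            ∃ ν : B →ₗ[R] (Fin p → E), matAct E C ∘ₗ ν = (e ξ).1 := by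
  obtain ⟨q, G₀, ι, _, hG₀J, hι, hX'⟩ := hX.exists_cosyzygy hJ
  obtain ⟨r, G₁, κ, hG₁, hG₁J, hκ⟩ := hX'.exists_embedding hJ
  have hker (x) : κ ((LinearMap.range ι).mkQ x) = 0 ↔ x ∈ LinearMap.range ι := by
    rw [map_eq_zero_iff κ hκ, Submodule.mkQ_apply, Submodule.Quotient.mk_eq_zero]
  obtain ⟨C, hC⟩ := exists_matAct_eq_of_prod (hG₀J.mono hJ) (ι ∘ₗ a)
  obtain ⟨C', hC'⟩ := exists_matAct_eq_of_prod (hG₁J.mono hJ) (κ ∘ₗ (LinearMap.range ι).mkQ)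
  refine ⟨r, q, C', C, ?_, ?_⟩
  · refine eq_zero_of_matAct_eq_zero (E := E) (LinearMap.ext fun v ↦ ?_)
    rw [← matAct_comp, LinearMap.comp_apply]
    have := hC' (matAct E C v)
    rw [← hC, LinearMap.comp_apply, LinearMap.comp_apply,
      (hker _).2 (LinearMap.mem_range_self ι (a (v, 0)))] at this
    exact (congrArg Prod.fst this).symm
  · intro B _ _ hB
    have hmem (v) : (v, 0) ∈ LinearMap.range ι ↔ matAct E C' v = 0 := by
      rw [← hker, ← LinearMap.comp_apply, hC', Prod.mk_eq_zero, and_iff_left rfl]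
    have hsnd (ξ : B →ₗ[R] X) (b) : ι (ξ b) = ((ι (ξ b)).1, 0) := Prod.ext rfl
      (LinearMap.congr_fun (hG₀J.hom_eq_zero hB (LinearMap.snd R (Fin q → E) G₀ ∘ₗ ι ∘ₗ ξ)) b)
    let e₀ : (B →ₗ[R] X) →ₗ[R] (B →ₗ[R] (Fin q → E)) :=
      LinearMap.llcomp R B X (Fin q → E) (LinearMap.fst R (Fin q → E) G₀ ∘ₗ ι)
    let e : (B →ₗ[R] X) →ₗ[R]
        LinearMap.ker (LinearMap.llcomp R B (Fin q → E) (Fin r → E) (matAct E C')) :=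
      LinearMap.codRestrict _ e₀ fun ξ ↦ LinearMap.ext fun b ↦ by
        refine (hmem (ι (ξ b)).1).1 ?_
        rw [← hsnd]
        exact LinearMap.mem_range_self _ _
    have he (ξ b) : (e ξ).1 b = (ι (ξ b)).1 := rfl
    refine ⟨e, ?_, ?_⟩
    · rintro ⟨ψ, hψ⟩
      let ξ := LinearMap.factorInjective ι hι (LinearMap.inl R (Fin q → E) G₀ ∘ₗ ψ)
        fun b ↦ (hmem (ψ b)).2 (LinearMap.congr_fun hψ b)
      refine ⟨ξ, Subtype.ext (LinearMap.ext fun b ↦ ?_)⟩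
      exact congrArg Prod.fst (LinearMap.apply_factorInjective ι hι _ _ b)
    · intro ξ
      constructor
      · rintro ⟨ν, rfl⟩
        have h2 := hG'.hom_eq_zero hB (LinearMap.snd R (Fin p → E) G' ∘ₗ ν)
        refine ⟨LinearMap.fst R (Fin p → E) G' ∘ₗ ν, LinearMap.ext fun b ↦ ?_⟩
        have h3 : ν b = ((ν b).1, 0) := Prod.ext rfl (LinearMap.congr_fun h2 b)
        have h4 := hC (ν b).1
        rw [← h3] at h4
        exact (congrArg Prod.fst h4).symm
      · rintro ⟨ν, hν⟩
        refine ⟨LinearMap.inl R (Fin p → E) G' ∘ₗ ν, LinearMap.ext fun b ↦ hι ?_⟩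
        refine (hC (ν b)).trans (Eq.trans ?_ (hsnd ξ b).symm)
        rw [← he, ← hν]
        rfl

theorem exists_surjective_dual_matCohomology {J : Ideal R} (hJ : J ≤ maximalIdeal R) {X : Type u}
    [AddCommGroup X] [Module R X] (hX : HasSmallExt R E J X) {p : ℕ} {G' : Type u}
    [AddCommGroup G'] [Module R G'] (hG' : IsTorsionFreeAt J G')
    (a : ((Fin p → E) × G') →ₗ[R] X) (N : Type u) [AddCommGroup N] [Module R N] :
    ∃ (r q : ℕ) (C' : Matrix (Fin r) (Fin q) R) (C : Matrix (Fin q) (Fin p) R), C' * C = 0 ∧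
      ∀ K : Ideal R, IsKilledByPower J (N ⧸ (K • ⊤ : Submodule R N)) →
        ∃ Θ : ((N ⧸ (K • ⊤ : Submodule R N)) →ₗ[R] X) →ₗ[R] (MatCohomology N C' C K →ₗ[R] E),
          Function.Surjective Θ ∧ ∀ ξ, Θ ξ = 0 ↔
            ∃ ν : (N ⧸ (K • ⊤ : Submodule R N)) →ₗ[R] (Fin p → E) × G', a ∘ₗ ν = ξ := by
  obtain ⟨r, q, C', C, hC, h⟩ := hX.exists_matrices hJ hG' a
  refine ⟨r, q, C', C, hC, fun K hK ↦ ?_⟩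
  obtain ⟨e, he, he'⟩ := h _ hK
  obtain ⟨Θ, hΘ, hΘ'⟩ := exists_dual_cohomology_map (E := E) C' C (K • ⊤ : Submodule R N) (K • ⊤)
    (K • ⊤) (Submodule.mem_ideal_smul_top_pi K) (Submodule.mem_ideal_smul_top_pi K)
  exact ⟨Θ ∘ₗ e, hΘ.comp he, fun ξ ↦ (hΘ' _).trans (he' ξ).symm⟩

/-- For a small module `X`, the Hom modules into `X` are dual to matrix cohomology. -/
theorem HasSmallExt.exists_hom_equiv {J : Ideal R} (hJ : J ≤ maximalIdeal R) {X : Type u}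
    [AddCommGroup X] [Module R X] (hX : HasSmallExt R E J X) (N : Type u) [AddCommGroup N]
    [Module R N] :
    ∃ (r q p : ℕ) (C' : Matrix (Fin r) (Fin q) R) (C : Matrix (Fin q) (Fin p) R), C' * C = 0 ∧
      ∀ K : Ideal R, IsKilledByPower J (N ⧸ (K • ⊤ : Submodule R N)) →
        Nonempty (((N ⧸ (K • ⊤ : Submodule R N)) →ₗ[R] X) ≃ₗ[R]
          (MatCohomology N C' C K →ₗ[R] E)) := by
  have hG : IsTorsionFreeAt J PUnit.{u + 1} := fun _ _ ↦ rfl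
  obtain ⟨r, q, C', C, hC, h⟩ := exists_surjective_dual_matCohomology hJ hX (p := 0) hG 0 N
  refine ⟨r, q, 0, C', C, hC, fun K hK ↦ ?_⟩
  obtain ⟨Θ, hΘ, hΘ'⟩ := h K hK
  refine ⟨LinearEquiv.ofBijective Θ ⟨(injective_iff_map_eq_zero Θ).2 fun ξ hξ ↦ ?_, hΘ⟩⟩
  obtain ⟨ν, hν⟩ := (hΘ' ξ).1 hξ
  rw [← hν, LinearMap.zero_comp]

/-- For a small module `X`, the higher Ext modules into `X` are dual to matrix cohomology. -/
theorem HasSmallExt.exists_cohomology_equiv {J : Ideal R} (hJ : J ≤ maximalIdeal R) (j : ℕ)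
    (N : Type u) [AddCommGroup N] [Module R N] {X : Type u} [AddCommGroup X] [Module R X]
    (hX : HasSmallExt R E J X) :
    ∃ (r q p : ℕ) (C' : Matrix (Fin r) (Fin q) R) (C : Matrix (Fin q) (Fin p) R), C' * C = 0 ∧
      ∀ K : Ideal R, IsKilledByPower J (N ⧸ (K • ⊤ : Submodule R N)) →
        ∀ P : FreeRes R (N ⧸ (K • ⊤ : Submodule R N)),
        Nonempty (HomCohomology (P.d (j + 1)) (P.d j) X ≃ₗ[R]
          (MatCohomology N C' C K →ₗ[R] E)) := by
  induction j generalizing X with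
  | zero =>
    obtain ⟨p, G₀, ι, _, hG₀J, hι, hX'⟩ := hX.exists_cosyzygy hJ
    obtain ⟨r, q, C', C, hC, h⟩ :=
      exists_surjective_dual_matCohomology hJ hX' hG₀J (LinearMap.range ι).mkQ N
    refine ⟨r, q, p, C', C, hC, fun K hK P ↦ ?_⟩
    obtain ⟨Θ, hΘ, hΘ'⟩ := h K hK
    obtain ⟨δ, hδ, hδ'⟩ := exists_connecting_hom_of_surjective (P.d 1) (P.d 0) P.ε (P.exact_d 0)
      P.exact_ε P.surjective_ε ι _ hι (Submodule.mkQ_surjective _) ι.exact_mkQ_range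
    refine ⟨(δ.quotKerEquivOfSurjective hδ).symm.trans
      ((Submodule.quotEquivOfEq _ _ ?_).trans (Θ.quotKerEquivOfSurjective hΘ))⟩
    ext ξ
    rw [LinearMap.mem_ker, LinearMap.mem_ker, hδ', hΘ']
  | succ j ih =>
    obtain ⟨p, G₀, ι, _, hG₀J, hι, hX'⟩ := hX.exists_cosyzygy hJ
    obtain ⟨r, q, p, C', C, hC, h⟩ := ih hX'
    refine ⟨r, q, p, C', C, hC, fun K hK P ↦ ?_⟩
    obtain ⟨e⟩ := h K hK P
    obtain ⟨e'⟩ := nonempty_homCohomology_equiv (P.d (j + 2)) (P.d (j + 1)) (P.d j)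
      (P.exact_d _) (P.exact_d _) ι _ hι (Submodule.mkQ_surjective _) ι.exact_mkQ_range
    exact ⟨e'.symm.trans e⟩

end

section

open IsLocalRing

variable {R : Type u} [CommRing R] [IsLocalRing R] [IsNoetherianRing R]
  [IsAdicComplete (maximalIdeal R) R]
  {E : Type u} [AddCommGroup E] [Module R E] [hE : IsResidueHull R E]

theorem isKilledByPower_quotient_smul_top {N : Type*} [AddCommGroup N] [Module R N] (I : Ideal R)
    (n : ℕ) :
    IsKilledByPower (I ⊔ Module.annihilator R N) (N ⧸ (I ^ n • ⊤ : Submodule R N)) := by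
  refine ⟨n + 1, fun a ha b ↦ ?_⟩
  obtain ⟨b, rfl⟩ := Submodule.Quotient.mk_surjective _ b
  obtain ⟨c, hc, e, he, rfl⟩ := Submodule.mem_sup.1 (Ideal.sup_pow_add_le_pow_sup_pow ha)
  rw [pow_one] at he
  rw [← Submodule.Quotient.mk_smul, Submodule.Quotient.mk_eq_zero, add_smul,
    Module.mem_annihilator.1 he b, add_zero]
  exact Submodule.smul_mem_smul hc Submodule.mem_top

/-- The length of a module that is dual to matrix cohomology is eventually polynomial. -/
theorem eventuallyPolynomial_length_of_equiv {N : Type u} [AddCommGroup N] [Module R N]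
    [Module.Finite R N] (I : Ideal R) {r q p : ℕ} {C' : Matrix (Fin r) (Fin q) R}
    {C : Matrix (Fin q) (Fin p) R} (hC : C' * C = 0) (F : ℕ → Type u)
    [∀ n, AddCommGroup (F n)] [∀ n, Module R (F n)]
    (hF : ∀ n, Nonempty (F n ≃ₗ[R] (MatCohomology N C' C (I ^ n) →ₗ[R] E)))
    (hfin : ∀ᶠ n in Filter.atTop, Module.length R (F n) ≠ ⊤) :
    EventuallyPolynomial fun n ↦ ((Module.length R (F n)).toNat : ℚ) := by
  have hlen (n) : Module.length R (F n) = relLength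
      (LinearMap.range (matAct N C'.transpose) ⊔ (I ^ n • ⊤ : Submodule R (Fin q → N)))
      ((I ^ n • ⊤ : Submodule R (Fin p → N)).comap (matAct N C.transpose)) := by
    obtain ⟨e⟩ := hF n
    exact e.length_eq.trans (MatlisReflexive.length_dual (.of_finite E))
  simp only [hlen] at hfin ⊢
  refine eventuallyPolynomial_relLength_complex I _ _ ?_ hfin
  rw [matAct_comp, ← Matrix.transpose_mul, hC, Matrix.transpose_zero]
  refine LinearMap.ext fun x ↦ funext fun j ↦ ?_
  simp [matAct_apply]

theorem eventuallyPolynomial_length_extModule {M : Type u} [AddCommGroup M] [Module R M]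
    (hM : MatlisReflexive R E M) (I : Ideal R) (N : Type u) [AddCommGroup N] [Module R N]
    [Module.Finite R N] (hsupp : Module.support R M ∩ Module.support R N ∩
        PrimeSpectrum.zeroLocus (I : Set R) =
      {⟨IsLocalRing.maximalIdeal R, (IsLocalRing.maximalIdeal.isMaximal R).isPrime⟩})
    (i : ℕ) (hfin : ∀ᶠ n in Filter.atTop,
      Module.length R (extModule R i (N ⧸ (I ^ n • ⊤ : Submodule R N)) M) ≠ ⊤) :
    EventuallyPolynomial fun n ↦
      ((Module.length R (extModule R i (N ⧸ (I ^ n • ⊤ : Submodule R N)) M)).toNat : ℚ) := by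
  let J := I ⊔ Module.annihilator R N
  have hJ : J ≤ maximalIdeal R := by
    obtain ⟨⟨-, hN⟩, hI⟩ := hsupp.ge (Set.mem_singleton _)
    exact sup_le hI (Module.annihilator_le_of_mem_support hN)
  have hsmall : HasSmallExt R E J M := by
    refine hM.hasSmallExt fun S hS t ↦ ?_
    have : Module.Finite R S := Module.Finite.iff_fg.2 hS
    refine Ideal.exists_pow_le_of_le_radical_of_fg ?_ (IsNoetherian.noetherian _)
    rw [Ideal.radical_eq_sInf]
    refine le_sInf fun P ⟨hle, hP⟩ ↦ ?_
    have hJP : J ≤ P := hP.le_of_pow_le (le_sup_left.trans hle)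
    have hmem : (⟨P, hP⟩ : PrimeSpectrum R) ∈ Module.support R M ∩ Module.support R N ∩
        PrimeSpectrum.zeroLocus (I : Set R) :=
      ⟨⟨Module.support_subset_of_injective S.subtype S.injective_subtype
        ((Module.mem_support_iff_of_finite (M := S)).2 (le_sup_right.trans hle)),
        (Module.mem_support_iff_of_finite (M := N)).2 (le_sup_right.trans hJP)⟩,
        le_sup_left.trans hJP⟩
    rw [hsupp] at hmem
    exact (congrArg PrimeSpectrum.asIdeal hmem).ge
  cases i with
  | zero =>
    obtain ⟨r, q, p, C', C, hC, h⟩ := hsmall.exists_hom_equiv hJ N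
    refine eventuallyPolynomial_length_of_equiv (E := E) (N := N) I hC
      (fun n ↦ extModule R 0 (N ⧸ (I ^ n • ⊤ : Submodule R N)) M) (fun n ↦ ?_) hfin
    obtain ⟨e⟩ := h (I ^ n) (isKilledByPower_quotient_smul_top I n)
    obtain ⟨P⟩ := FreeRes.nonempty R (N ⧸ (I ^ n • ⊤ : Submodule R N))
    obtain ⟨e'⟩ := P.nonempty_extModule_zero_equiv M
    exact ⟨e'.trans e⟩
  | succ j =>
    obtain ⟨r, q, p, C', C, hC, h⟩ := hsmall.exists_cohomology_equiv hJ j N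
    refine eventuallyPolynomial_length_of_equiv (E := E) (N := N) I hC
      (fun n ↦ extModule R (j + 1) (N ⧸ (I ^ n • ⊤ : Submodule R N)) M) (fun n ↦ ?_) hfin
    obtain ⟨P⟩ := FreeRes.nonempty R (N ⧸ (I ^ n • ⊤ : Submodule R N))
    obtain ⟨e⟩ := h (I ^ n) (isKilledByPower_quotient_smul_top I n) P
    obtain ⟨e'⟩ := P.nonempty_extModule_succ_equiv M j
    exact ⟨e'.trans e⟩

end

/-- Corollary 6(c). Let `(R, m)` be a complete commutative Noetherian
local ring, `E` an injective `R`-module containing `R/m` as an essential submodule, and `M`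
a Matlis reflexive `R`-module (the evaluation map `M → Hom(Hom(M, E), E)` is bijective).
Let `I` be an ideal and `N` a finitely generated `R`-module with
`Supp(M) ∩ Supp(N) ∩ V(I) = {m}`.  Fix `i ≥ 0` and assume `Ext_R^i(N/IⁿN, M)` has finite
length for all `n ≫ 0`.  Then there is a polynomial `p ∈ ℚ[X]` with
`λ(Ext_R^i(N/IⁿN, M)) = p(n)` for all `n ≫ 0`. -/
theorem stmt_14 {R : Type u} [CommRing R] [IsNoetherianRing R] [IsLocalRing R]
    [IsAdicComplete (IsLocalRing.maximalIdeal R) R]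
    (E : Type u) [AddCommGroup E] [Module R E] (hEinj : Module.Injective R E)
    (f : (R ⧸ IsLocalRing.maximalIdeal R) →ₗ[R] E) (hf : Function.Injective f)
    (hess : ∀ S : Submodule R E, S ≠ ⊥ → S ⊓ LinearMap.range f ≠ ⊥)
    (M : Type u) [AddCommGroup M] [Module R M]
    (hrefl : Function.Bijective (matlisEval R M E))
    (I : Ideal R) (N : Type u) [AddCommGroup N] [Module R N] [Module.Finite R N]
    (hsupp : Module.support R M ∩ Module.support R N ∩
        PrimeSpectrum.zeroLocus (I : Set R) =
      {⟨IsLocalRing.maximalIdeal R, (IsLocalRing.maximalIdeal.isMaximal R).isPrime⟩})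
    (i : ℕ)
    (hfin : ∃ N₀ : ℕ, ∀ n ≥ N₀,
      IsFiniteLength R (extModule R i (N ⧸ (I ^ n • ⊤ : Submodule R N)) M)) :
    ∃ (p : Polynomial ℚ) (N₀ : ℕ), ∀ n ≥ N₀, ∃ ℓ : ℕ,
      moduleLength R (extModule R i (N ⧸ (I ^ n • ⊤ : Submodule R N)) M) = ℓ ∧
      (ℓ : ℚ) = p.eval (n : ℚ) := by
  have : IsResidueHull R E := { toInjective := hEinj, exists_embedding := ⟨f, hf, hess⟩ }
  obtain ⟨N₀, hN₀⟩ := hfin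
  have hlen (n : ℕ) (hn : n ≥ N₀) :
      Module.length R (extModule R i (N ⧸ (I ^ n • ⊤ : Submodule R N)) M) ≠ ⊤ :=
    Module.length_ne_top_iff.2 (hN₀ n hn)
  obtain ⟨p, hp⟩ := eventuallyPolynomial_length_extModule (E := E) hrefl.2 I N hsupp i
    (Filter.eventually_atTop.2 ⟨N₀, hlen⟩)
  obtain ⟨N₁, hN₁⟩ := Filter.eventually_atTop.1 hp
  refine ⟨p, max N₀ N₁, fun n hn ↦ ⟨_, ?_, hN₁ n (le_of_max_le_right hn)⟩⟩
  rw [moduleLength, ← Module.coe_length]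
  exact congrArg WithBot.some (ENat.natCast_toNat (hlen n (le_of_max_le_left hn))).symm
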